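/- arXiv:0802.1804 — 5 statements merged into one kernel-verified Lean document; each statement's English description precedes it below -/
import Mathlib

section
/- Let N ≥ 3 and let φ : ℝ^N → ℝ be a smooth function with compact support, with φ not identically zero. Then ∫_{ℝ^N} ‖∇φ(x)‖² dx > ((N−2)/2)² ∫_{ℝ^N} φ(x)²/‖x‖² dx. -/
open MeasureTheory

namespace HardyAux

open Filter Topology

variable {N : ℕ}

lemma integral_fderiv_zero (g : EuclideanSpace ℝ (Fin N) → ℝ) (hg : ContDiff ℝ 1 g)
    (hs : HasCompactSupport g) (v : EuclideanSpace ℝ (Fin N)) :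
    Integrable (fun x => fderiv ℝ g x v) ∧ ∫ x, fderiv ℝ g x v = 0 := by
  have hi : Integrable (fun x => fderiv ℝ g x v) := by
    apply Continuous.integrable_of_hasCompactSupport
    · exact (hg.continuous_fderiv one_ne_zero).clm_apply continuous_const
    · exact hs.fderiv_apply ℝ v
  refine ⟨hi, ?_⟩
  have := integral_mul_fderiv_eq_neg_fderiv_mul_of_integrable (μ := volume)
    (f := fun _ : EuclideanSpace ℝ (Fin N) => (1 : ℝ)) (g := g) (v := v)
    (by simp) (by simpa using hi)
    (by simpa using hg.continuous.integrable_of_hasCompactSupport hs)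
    (by intro x _; fun_prop) (by intro x _; exact (hg.differentiable one_ne_zero) x)
  simpa using this

/-- The regularised divergence. -/
noncomputable def h (φ : EuclideanSpace ℝ (Fin N) → ℝ) (ε : ℝ) (x : EuclideanSpace ℝ (Fin N)) : ℝ :=
  2 * φ x * fderiv ℝ φ x x / (‖x‖ ^ 2 + ε)
    + φ x ^ 2 * (N / (‖x‖ ^ 2 + ε) - 2 * ‖x‖ ^ 2 / (‖x‖ ^ 2 + ε) ^ 2)

lemma integral_h (φ : EuclideanSpace ℝ (Fin N) → ℝ) (hφ : ContDiff ℝ 1 φ)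
    (hs : HasCompactSupport φ) (ε : ℝ) (hε : 0 < ε) : ∫ x, h φ ε x = 0 := by
  let u : Fin N → EuclideanSpace ℝ (Fin N) → ℝ := fun i x => φ x * (φ x * (x i / (‖x‖ ^ 2 + ε)))
  have hpos : ∀ x : EuclideanSpace ℝ (Fin N), ‖x‖ ^ 2 + ε ≠ 0 := fun x => by positivity
  have hco : ∀ i, ContDiff ℝ 1 (fun x : EuclideanSpace ℝ (Fin N) => x i) := fun i => by fun_prop
  have hu : ∀ i, ContDiff ℝ 1 (u i) := fun i =>
    hφ.mul (hφ.mul ((hco i).div ((contDiff_norm_sq ℝ).add contDiff_const) hpos))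
  have hus : ∀ i, HasCompactSupport (u i) := fun i => hs.mul_right
  have hd : ∀ i x, fderiv ℝ (u i) x (EuclideanSpace.single i 1) =
      2 * φ x * (fderiv ℝ φ x (EuclideanSpace.single i 1) * x i) / (‖x‖ ^ 2 + ε)
      + φ x ^ 2 * (1 / (‖x‖ ^ 2 + ε) - 2 * (x i) ^ 2 / (‖x‖ ^ 2 + ε) ^ 2) := by
    intro i x
    have h1 : HasFDerivAt φ (fderiv ℝ φ x) x := ((hφ.differentiable one_ne_zero) x).hasFDerivAt
    have h2 : HasFDerivAt (fun x : EuclideanSpace ℝ (Fin N) => x i)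
        (EuclideanSpace.proj i : EuclideanSpace ℝ (Fin N) →L[ℝ] ℝ) x :=
      (EuclideanSpace.proj i : EuclideanSpace ℝ (Fin N) →L[ℝ] ℝ).hasFDerivAt
    have h3 : HasFDerivAt (fun x : EuclideanSpace ℝ (Fin N) => ‖x‖ ^ 2 + ε)
        (2 • (innerSL ℝ x)) x := (hasStrictFDerivAt_norm_sq x).hasFDerivAt.add_const ε
    have h4 := h1.mul (h1.mul (h2.mul ((hasDerivAt_inv (hpos x)).comp_hasFDerivAt x h3)))
    have h5 : HasFDerivAt (u i) _ x := h4
    rw [h5.fderiv]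
    have := hpos x
    simp [EuclideanSpace.inner_single_right]
    field_simp
    ring
  have hsum : ∀ x, h φ ε x = ∑ i, fderiv ℝ (u i) x (EuclideanSpace.single i 1) := by
    intro x
    simp only [hd, Finset.sum_add_distrib, ← Finset.sum_div, ← Finset.mul_sum,
      Finset.sum_sub_distrib]
    have e1 : ∑ i, fderiv ℝ φ x (EuclideanSpace.single i 1) * x i = fderiv ℝ φ x x := by
      have hx : x = ∑ i, x i • EuclideanSpace.single i (1 : ℝ) := by
        ext j; simp [Finset.sum_apply, Pi.single_apply]
      have hx2 : fderiv ℝ φ x x = fderiv ℝ φ x (∑ i, x i • EuclideanSpace.single i (1 : ℝ)) :=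
        congrArg _ hx
      rw [hx2, map_sum]
      simp only [map_smul, smul_eq_mul]
      exact Finset.sum_congr rfl fun i _ => mul_comm _ _
    rw [e1, ← EuclideanSpace.real_norm_sq_eq]
    simp [h, div_eq_mul_inv]
  simp only [hsum]
  rw [integral_finsetSum _ (fun i _ => (integral_fderiv_zero (u i) (hu i) (hus i) _).1)]
  exact Finset.sum_eq_zero fun i _ => (integral_fderiv_zero (u i) (hu i) (hus i) _).2

lemma h_bound (φ : EuclideanSpace ℝ (Fin N) → ℝ) (ε : ℝ) (hε : 0 ≤ ε)
    (x : EuclideanSpace ℝ (Fin N)) (hx : x ≠ 0) :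
    ‖h φ ε x‖ ≤ ‖gradient φ x‖ ^ 2 + (N + 3) * (φ x ^ 2 / ‖x‖ ^ 2) := by
  have hn : 0 < ‖x‖ := norm_pos_iff.2 hx
  set r := ‖x‖ with hr
  have hg : |fderiv ℝ φ x x| ≤ ‖gradient φ x‖ * r := by
    rw [← inner_gradient_left]; exact abs_real_inner_le_norm _ _
  set G := ‖gradient φ x‖
  have hG : 0 ≤ G := norm_nonneg _
  set d := fderiv ℝ φ x x
  set a := φ x
  set s := (r ^ 2 + ε)⁻¹ with hs
  have hs0 : 0 < s := by positivity
  have hsr : s ≤ (r ^ 2)⁻¹ := by rw [hs]; gcongr; linarith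
  have hsr1 : s * r ^ 2 ≤ 1 := by
    calc s * r ^ 2 ≤ (r ^ 2)⁻¹ * r ^ 2 := by gcongr
      _ = 1 := by field_simp
  have hh : h φ ε x = 2 * a * d * s + a ^ 2 * (N * s - 2 * (s * r ^ 2) * s) := by
    simp only [h, hs, div_eq_mul_inv, ← inv_pow, a, d, r]; ring
  rw [hh, Real.norm_eq_abs]
  have ha2 : a ^ 2 * s ≤ a ^ 2 / r ^ 2 := by rw [div_eq_mul_inv]; gcongr
  have b1 : |2 * a * d * s| ≤ G ^ 2 + a ^ 2 * s := by
    have : |2 * a * d * s| = 2 * |a| * |d| * s := by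
      rw [abs_mul, abs_mul, abs_mul, abs_of_pos hs0]; simp
    rw [this]
    calc 2 * |a| * |d| * s ≤ 2 * |a| * (G * r) * s := by gcongr
      _ = 2 * G * (|a| * s * r) := by ring
      _ ≤ G ^ 2 + (|a| * s * r) ^ 2 := by nlinarith [sq_nonneg (G - |a| * s * r)]
      _ = G ^ 2 + a ^ 2 * s * (s * r ^ 2) := by rw [mul_pow, mul_pow, sq_abs]; ring
      _ ≤ G ^ 2 + a ^ 2 * s * 1 := by gcongr
      _ = _ := by ring
  have b2 : |a ^ 2 * (N * s - 2 * (s * r ^ 2) * s)| ≤ (N + 2) * (a ^ 2 * s) := by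
    have e : a ^ 2 * (N * s - 2 * (s * r ^ 2) * s) = (a ^ 2 * s) * (N - 2 * (s * r ^ 2)) := by ring
    have hN : (0 : ℝ) ≤ N := Nat.cast_nonneg N
    have h0 : 0 ≤ s * r ^ 2 := by positivity
    rw [e, abs_mul, abs_of_nonneg (by positivity : 0 ≤ a ^ 2 * s), mul_comm]
    gcongr
    rw [abs_le]; constructor <;> linarith
  calc _ ≤ _ := abs_add_le _ _
    _ ≤ G ^ 2 + a ^ 2 * s + (N + 2) * (a ^ 2 * s) := add_le_add b1 b2
    _ = G ^ 2 + (N + 3) * (a ^ 2 * s) := by ring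
    _ ≤ _ := by gcongr

lemma measurable_h (φ : EuclideanSpace ℝ (Fin N) → ℝ) (hφ : ContDiff ℝ 1 φ) (ε : ℝ) :
    Measurable (h φ ε) := by
  have h1 : Measurable (fun x => fderiv ℝ φ x x) :=
    ((hφ.continuous_fderiv one_ne_zero).clm_apply continuous_id).measurable
  have h2 : Measurable φ := hφ.continuous.measurable
  unfold h
  fun_prop

lemma integrable_grad (φ : EuclideanSpace ℝ (Fin N) → ℝ) (hφ : ContDiff ℝ 1 φ)
    (hs : HasCompactSupport φ) : Continuous (gradient φ) ∧
      Integrable (fun x => ‖gradient φ x‖ ^ 2) := by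
  have hc : Continuous (gradient φ) :=
    (InnerProductSpace.toDual ℝ _).symm.continuous.comp (hφ.continuous_fderiv one_ne_zero)
  refine ⟨hc, ?_⟩
  apply (hc.norm.pow 2).integrable_of_hasCompactSupport
  refine (hs.fderiv ℝ).mono' fun x hx => subset_tsupport _ ?_
  intro h0
  apply hx
  simp [gradient, h0]

lemma h_zero (hN : 3 ≤ N) (φ : EuclideanSpace ℝ (Fin N) → ℝ) (hφ : ContDiff ℝ 1 φ)
    (hs : HasCompactSupport φ) (hi : Integrable (fun x => φ x ^ 2 / ‖x‖ ^ 2)) :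
    Integrable (h φ 0) ∧ ∫ x, h φ 0 x = 0 := by
  have : Nonempty (Fin N) := ⟨⟨0, by omega⟩⟩
  have hae : ∀ᵐ x : EuclideanSpace ℝ (Fin N), x ≠ 0 := Measure.ae_ne volume 0
  have hb : Integrable (fun x => ‖gradient φ x‖ ^ 2 + (N + 3) * (φ x ^ 2 / ‖x‖ ^ 2)) :=
    (integrable_grad φ hφ hs).2.add (hi.const_mul _)
  refine ⟨hb.mono' (measurable_h φ hφ 0).aestronglyMeasurable ?_, ?_⟩
  · filter_upwards [hae] with x hx using h_bound φ 0 le_rfl x hx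
  have ht := tendsto_integral_of_dominated_convergence
    (F := fun (n : ℕ) x => h φ (1 / ((n : ℝ) + 1)) x) (f := h φ 0) (μ := volume) _
    (fun n => (measurable_h φ hφ _).aestronglyMeasurable) hb
    (fun n => by
      filter_upwards [hae] with x hx using h_bound φ _ (by positivity) x hx)
    (by
      filter_upwards [hae] with x hx
      have hx0 : ‖x‖ ^ 2 + 0 ≠ 0 := by simpa using hx
      have hc : ContinuousAt (fun ε => h φ ε x) 0 := by
        unfold h
        have : (‖x‖ ^ 2 + 0) ^ 2 ≠ 0 := pow_ne_zero _ hx0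
        fun_prop (disch := assumption)
      exact hc.tendsto.comp tendsto_one_div_add_atTop_nhds_zero_nat)
  have hz : ∀ n : ℕ, ∫ x, h φ (1 / ((n : ℝ) + 1)) x = 0 := fun n =>
    integral_h φ hφ hs _ (by positivity)
  simp only [hz] at ht
  exact (tendsto_nhds_unique ht tendsto_const_nhds)

lemma zero_of_euler (φ : EuclideanSpace ℝ (Fin N) → ℝ) (hφ : ContDiff ℝ 1 φ)
    (hs : HasCompactSupport φ) (c : ℝ) (hc : 0 < c)
    (he : ∀ x, fderiv ℝ φ x x + c * φ x = 0) : φ = 0 := by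
  funext x
  by_cases hx : x = 0
  · subst hx
    have := he 0
    simp at this
    exact this.resolve_left hc.ne'
  let f : ℝ → ℝ := fun t => Real.exp (c * t) * φ (Real.exp t • x)
  have hd : ∀ t, HasDerivAt f 0 t := by
    intro t
    have h1 : HasDerivAt (fun t => Real.exp t • x) (Real.exp t • x) t :=
      (Real.hasDerivAt_exp t).smul_const x
    have h2 := ((hφ.differentiable one_ne_zero) (Real.exp t • x)).hasFDerivAt.comp_hasDerivAt t h1
    have h3 : HasDerivAt (fun t => Real.exp (c * t)) (Real.exp (c * t) * (c * 1)) t :=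
      ((hasDerivAt_id t).const_mul c).exp
    refine (h3.mul h2).congr_deriv ?_
    have := he (Real.exp t • x)
    simp only [Function.comp]
    linear_combination (Real.exp (c * t)) * this
  have hconst : ∀ t, f t = f 0 := fun t =>
    is_const_of_deriv_eq_zero (fun t => (hd t).differentiableAt) (fun t => (hd t).deriv) t 0
  obtain ⟨R, hR⟩ := hs.isCompact.isBounded.exists_norm_le
  have hn : 0 < ‖x‖ := norm_pos_iff.2 hx
  have htend : Tendsto (fun t => Real.exp t * ‖x‖) atTop atTop :=
    Real.tendsto_exp_atTop.atTop_mul_const hn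
  obtain ⟨t, ht⟩ := (htend.eventually_gt_atTop R).exists
  have hz : φ (Real.exp t • x) = 0 := by
    by_contra hne
    have := hR _ (subset_tsupport φ hne)
    rw [norm_smul, Real.norm_eq_abs, Real.abs_exp] at this
    linarith
  have := hconst t
  simp [f, hz] at this
  simpa using this.symm

end HardyAux

open HardyAux in
/-- **Hardy's inequality (strict form).**
For `N ≥ 3` and a smooth compactly supported `φ : ℝ^N → ℝ` which is not identically zero,
`∫ ‖∇φ‖² > ((N-2)/2)² ∫ φ²/‖x‖²`. -/
theorem hardy_inequality_strict (N : ℕ) (hN : 3 ≤ N)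
    (φ : EuclideanSpace ℝ (Fin N) → ℝ)
    (hsmooth : ContDiff ℝ (⊤ : ℕ∞) φ) (hsupp : HasCompactSupport φ)
    (hne : φ ≠ 0) :
    (((N : ℝ) - 2) / 2) ^ 2 * ∫ x, (φ x) ^ 2 / ‖x‖ ^ 2 <
      ∫ x, ‖gradient φ x‖ ^ 2 := by
  have hφ : ContDiff ℝ 1 φ := hsmooth.of_le (by exact_mod_cast le_top)
  have : Nonempty (Fin N) := ⟨⟨0, by omega⟩⟩
  obtain ⟨hgc, hgi⟩ := integrable_grad φ hφ hsupp
  set c : ℝ := ((N : ℝ) - 2) / 2 with hcdef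
  have hN' : (3 : ℝ) ≤ N := by exact_mod_cast hN
  have hc : 0 < c := by rw [hcdef]; linarith
  by_cases hi : Integrable (fun x => φ x ^ 2 / ‖x‖ ^ 2)
  · obtain ⟨h0i, h0⟩ := h_zero hN φ hφ hsupp hi
    by_contra hlt
    push Not at hlt
    let W : EuclideanSpace ℝ (Fin N) → EuclideanSpace ℝ (Fin N) := fun x =>
      gradient φ x + (c * φ x * (‖x‖ ^ 2)⁻¹) • x
    have hW : ∀ x, ‖W x‖ ^ 2 =
        ‖gradient φ x‖ ^ 2 - c ^ 2 * (φ x ^ 2 / ‖x‖ ^ 2) + c * h φ 0 x := by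
      intro x
      have hinv : (‖x‖ ^ 2)⁻¹ * (‖x‖ ^ 2)⁻¹ * ‖x‖ ^ 2 = (‖x‖ ^ 2)⁻¹ := by
        by_cases hx : x = 0
        · simp [hx]
        · have : ‖x‖ ≠ 0 := norm_ne_zero_iff.2 hx
          field_simp
      simp only [W, h]
      rw [norm_add_sq_real, inner_smul_right, inner_gradient_left, norm_smul, mul_pow,
        Real.norm_eq_abs, sq_abs, add_zero]
      have hNc : (N : ℝ) = 2 * c + 2 := by rw [hcdef]; ring
      rw [hNc]
      simp only [div_eq_mul_inv, ← inv_pow] at *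
      linear_combination (c ^ 2 * φ x ^ 2 + 2 * c * φ x ^ 2) * hinv
    have hWi : Integrable (fun x => ‖W x‖ ^ 2) := by
      simp only [hW]
      exact (hgi.sub (hi.const_mul _)).add (h0i.const_mul _)
    have hWle : ∫ x, ‖W x‖ ^ 2 ≤ 0 := by
      simp only [hW]
      have hsub : Integrable (fun x => ‖gradient φ x‖ ^ 2 - c ^ 2 * (φ x ^ 2 / ‖x‖ ^ 2)) :=
        hgi.sub (hi.const_mul _)
      rw [integral_add hsub (h0i.const_mul _),
        integral_sub hgi (hi.const_mul _), integral_const_mul, integral_const_mul, h0]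
      linarith
    have hW0 : ∫ x, ‖W x‖ ^ 2 = 0 := le_antisymm hWle (integral_nonneg fun x => by positivity)
    rw [integral_eq_zero_iff_of_nonneg (fun x => by positivity) hWi] at hW0
    apply hne
    apply zero_of_euler φ hφ hsupp c hc
    have hcont : Continuous (fun x => fderiv ℝ φ x x + c * φ x) :=
      ((hφ.continuous_fderiv one_ne_zero).clm_apply continuous_id).add
        (continuous_const.mul hφ.continuous)
    have hq : (fun x => fderiv ℝ φ x x + c * φ x) =ᵐ[volume] fun _ => (0 : ℝ) := by
      filter_upwards [hW0, Measure.ae_ne volume (0 : EuclideanSpace ℝ (Fin N))] with x hx hx0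
      have hx1 : W x = 0 := by simpa using hx
      have hx2 : inner ℝ (W x) x = 0 := by rw [hx1, inner_zero_left]
      have hn : ‖x‖ ≠ 0 := norm_ne_zero_iff.2 hx0
      simp only [W] at hx2
      rw [inner_add_left, inner_gradient_left, real_inner_smul_left,
        real_inner_self_eq_norm_sq, mul_assoc, inv_mul_cancel₀ (pow_ne_zero 2 hn), mul_one] at hx2
      exact hx2
    have := (Continuous.ae_eq_iff_eq volume hcont continuous_const).1 hq
    exact fun x => congrFun this x
  · rw [integral_undef hi, mul_zero]
    refine lt_of_le_of_ne (integral_nonneg fun x => by positivity) fun h0 => hne ?_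
    have h0' := h0.symm
    rw [integral_eq_zero_iff_of_nonneg (fun x => by positivity) hgi] at h0'
    have hz := (Continuous.ae_eq_iff_eq volume (hgc.norm.pow 2) continuous_const).1 h0'
    have hf : ∀ x, fderiv ℝ φ x = 0 := by
      intro x
      have : gradient φ x = 0 := by
        have h2 : ‖gradient φ x‖ ^ 2 = 0 := congrFun hz x
        simpa using h2
      rw [← toDual_gradient, this, map_zero]
    have hconst := is_const_of_fderiv_eq_zero (hφ.differentiable one_ne_zero) hf
    have hnt : ∃ y, φ y = 0 := by
      by_contra hcon
      push Not at hcon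
      have hu : tsupport φ = Set.univ :=
        Set.eq_univ_of_forall fun y => subset_tsupport φ (hcon y)
      have := hsupp.isCompact
      rw [hu] at this
      exact noncompact_univ _ this
    obtain ⟨y, hy⟩ := hnt
    funext x
    rw [hconst x y, hy]; rfl
end

section
/- Let N ≥ 3, let Ω ⊆ ℝ^N be an open set with 0 ∈ Ω, and let c > μ* = ((N−2)/2)². Then there exists a test function φ on Ω, not identically zero, such that ∫_Ω ‖∇φ(x)‖² dx < c ∫_Ω φ(x)²/‖x‖² dx. (That is, μ* is the optimal constant in Hardy's inequality.) -/
open MeasureTheory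

lemma hardy_radial (M : ℕ) : ∃ K : ℝ, 0 < K ∧ ∀ h : ℝ → ℝ,
    ∫ x : EuclideanSpace ℝ (Fin (M + 3)), h (Real.log ‖x‖) / ‖x‖ ^ 2
      = K * ∫ t : ℝ, h t * Real.exp (((M : ℝ) + 1) * t) := by
  refine ⟨((M + 3 : ℕ) : ℝ) * (volume : Measure (EuclideanSpace ℝ (Fin (M + 3)))).real
    (Metric.ball 0 1), ?_, ?_⟩
  · have : 0 < (volume : Measure (EuclideanSpace ℝ (Fin (M + 3)))).real (Metric.ball 0 1) :=
      ENNReal.toReal_pos (Metric.measure_ball_pos _ _ one_pos).ne' measure_ball_lt_top.ne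
    positivity
  · intro h
    have h1 := integral_fun_norm_addHaar (volume : Measure (EuclideanSpace ℝ (Fin (M + 3))))
      (fun r => h (Real.log r) / r ^ 2)
    rw [h1]
    have h2 := integral_image_eq_integral_abs_deriv_smul (s := Set.univ) (f := Real.exp)
      (f' := Real.exp) MeasurableSet.univ
      (fun x _ => (Real.hasDerivAt_exp x).hasDerivWithinAt) Real.exp_injective.injOn
      (fun y => y ^ (M + 2) • (h (Real.log y) / y ^ 2))
    rw [Set.image_univ, Real.range_exp] at h2
    simp only [finrank_euclideanSpace, Fintype.card_fin, nsmul_eq_mul, smul_eq_mul,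
      show M + 3 - 1 = M + 2 from rfl] at h2 ⊢
    rw [h2, Measure.restrict_univ, mul_assoc]
    congr 2
    refine integral_congr_ae (Filter.Eventually.of_forall fun t => ?_)
    have e1 : Real.exp (((M : ℝ) + 1) * t) = Real.exp t ^ (M + 1) := by
      rw [← Real.exp_nat_mul]; push_cast; rfl
    have := Real.exp_pos t
    simp only [abs_of_pos this, Real.log_exp, e1]
    field_simp
    ring

/-- one-dimensional computation -/
lemma hardy_oneD (η : ℝ → ℝ) (hη : ContDiff ℝ (⊤ : ℕ∞) η) (hc : HasCompactSupport η)
    (a ε b : ℝ) (hε : 0 < ε) :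
    ∫ t, (ε * deriv η (ε * t + b) - a * η (ε * t + b)) ^ 2
      = ε⁻¹ * (ε ^ 2 * (∫ t, (deriv η t) ^ 2) + a ^ 2 * ∫ t, (η t) ^ 2) := by
  have hd : Continuous (deriv η) := hη.continuous_deriv (by simp)
  have hcd : HasCompactSupport (deriv η) := hc.deriv
  have i1 : Integrable (fun t => (deriv η t) ^ 2) :=
    (hd.pow 2).integrable_of_hasCompactSupport (by
      simpa [pow_two] using hcd.mul_left (f := deriv η))
  have i2 : Integrable (fun t => (η t) ^ 2) :=
    (hη.continuous.pow 2).integrable_of_hasCompactSupport (by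
      simpa [pow_two] using hc.mul_left (f := η))
  have i3 : Integrable (fun t => 2 * η t * deriv η t) :=
    ((continuous_const.mul hη.continuous).mul hd).integrable_of_hasCompactSupport
      (hcd.mul_left (f := fun t => 2 * η t))
  have z : ∫ t, 2 * η t * deriv η t = 0 := by
    refine integral_eq_zero_of_hasDerivAt_of_integrable (f := fun t => η t ^ 2) ?_ i3 i2
    intro t
    have := ((hη.differentiable (by simp)) t).hasDerivAt.pow 2
    exact this.congr_deriv (by simp)
  have s1 := Measure.integral_comp_mul_left
    (fun s => (ε * deriv η (s + b) - a * η (s + b)) ^ 2) ε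
  have s2 := integral_add_right_eq_self (μ := volume)
    (fun s => (ε * deriv η s - a * η s) ^ 2) b
  rw [s1, s2, abs_of_pos (inv_pos.2 hε), smul_eq_mul]
  congr 1
  have : (fun s => (ε * deriv η s - a * η s) ^ 2) = fun s =>
      (ε ^ 2 * (deriv η s) ^ 2 + a ^ 2 * (η s) ^ 2) - (a * ε) * (2 * η s * deriv η s) := by
    funext s; ring
  have i4 : Integrable (fun s => ε ^ 2 * (deriv η s) ^ 2 + a ^ 2 * (η s) ^ 2) :=
    (i1.const_mul _).add (i2.const_mul _)
  rw [this, integral_sub i4 (i3.const_mul _),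
    integral_add (i1.const_mul _) (i2.const_mul _), integral_const_mul, integral_const_mul,
    integral_const_mul, z]
  ring

lemma hardy_grad (N : ℕ) (g : ℝ → ℝ) (x : EuclideanSpace ℝ (Fin N)) (hx : x ≠ 0) (g' : ℝ)
    (hg : HasDerivAt g g' (Real.log ‖x‖)) :
    ‖gradient (fun x : EuclideanSpace ℝ (Fin N) => g (Real.log ‖x‖)) x‖ ^ 2
      = g' ^ 2 / ‖x‖ ^ 2 := by
  have hn : ‖x‖ ≠ 0 := norm_ne_zero_iff.2 hx
  have e : (fun x : EuclideanSpace ℝ (Fin N) => Real.log ‖x‖)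
      = fun x => (1 / 2 : ℝ) * Real.log (‖x‖ ^ 2) := by
    funext y; rw [Real.log_pow]; push_cast; ring
  have h1 : HasFDerivAt (fun x : EuclideanSpace ℝ (Fin N) => Real.log ‖x‖)
      ((1 / 2 : ℝ) • ((‖x‖ ^ 2)⁻¹ • ((2 : ℕ) • innerSL ℝ x))) x := by
    rw [e]
    exact ((hasStrictFDerivAt_norm_sq x).hasFDerivAt.log (by positivity)).const_mul _
  have h2 := hg.comp_hasFDerivAt x h1
  have h3 : fderiv ℝ (fun x : EuclideanSpace ℝ (Fin N) => g (Real.log ‖x‖)) x = _ := h2.fderiv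
  rw [gradient, LinearIsometryEquiv.norm_map, h3, ← Nat.cast_smul_eq_nsmul ℝ]
  simp only [norm_smul, innerSL_apply_norm]
  simp only [Real.norm_eq_abs, mul_pow, sq_abs]
  field_simp
  norm_num

/-- **Optimality of the Hardy constant.**
For `N ≥ 3`, an open set `Ω ⊆ ℝ^N` containing the origin, and any `c > μ* = ((N-2)/2)²`,
there is a nonzero test function `φ` on `Ω` with `∫_Ω ‖∇φ‖² < c ∫_Ω φ²/‖x‖²`. -/
theorem hardy_constant_optimal (N : ℕ) (hN : 3 ≤ N)
    (Ω : Set (EuclideanSpace ℝ (Fin N))) (hΩ : IsOpen Ω)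
    (h0 : (0 : EuclideanSpace ℝ (Fin N)) ∈ Ω)
    (c : ℝ) (hc : (((N : ℝ) - 2) / 2) ^ 2 < c) :
    ∃ φ : EuclideanSpace ℝ (Fin N) → ℝ,
      ContDiff ℝ (⊤ : ℕ∞) φ ∧ HasCompactSupport φ ∧ tsupport φ ⊆ Ω ∧ φ ≠ 0 ∧
      (∫ x in Ω, ‖gradient φ x‖ ^ 2) < c * ∫ x in Ω, (φ x) ^ 2 / ‖x‖ ^ 2 := by
  obtain ⟨M, rfl⟩ : ∃ M, N = M + 3 := ⟨N - 3, by omega⟩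
  set a : ℝ := (((M + 3 : ℕ) : ℝ) - 2) / 2 with ha
  have ha2 : 2 * a = (M : ℝ) + 1 := by rw [ha]; push_cast; ring
  -- the cutoff
  let B0 : ContDiffBump (0 : ℝ) := ⟨1, 2, one_pos, one_lt_two⟩
  obtain ⟨η, hη, hηc, hη0, hηz⟩ : ∃ η : ℝ → ℝ, ContDiff ℝ (⊤ : ℕ∞) η ∧ HasCompactSupport η ∧
      η 0 ≠ 0 ∧ ∀ t, 2 ≤ |t| → η t = 0 := by
    refine ⟨B0, B0.contDiff, B0.hasCompactSupport, ?_, ?_⟩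
    · rw [B0.one_of_mem_closedBall (by simp [B0])]; exact one_ne_zero
    · intro t ht
      exact B0.zero_of_le_dist (by simpa [B0] using ht)
  set A : ℝ := ∫ t, (deriv η t) ^ 2 with hA
  set B : ℝ := ∫ t, (η t) ^ 2 with hB
  have hA0 : 0 ≤ A := integral_nonneg fun t => sq_nonneg _
  have hB0 : 0 < B :=
    (hη.continuous.pow 2).integral_pos_of_hasCompactSupport_nonneg_nonzero
      (by simp only [pow_two]; exact hηc.mul_left (f := η)) (fun t => sq_nonneg _)
      (x := 0) (pow_ne_zero 2 hη0)
  have hd : 0 < c - a ^ 2 := sub_pos.2 hc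
  obtain ⟨ε, hε, hεA⟩ : ∃ ε : ℝ, 0 < ε ∧ ε ^ 2 * A < (c - a ^ 2) * B := by
    have hp : 0 < (c - a ^ 2) * B / (A + 1) := by positivity
    refine ⟨Real.sqrt ((c - a ^ 2) * B / (A + 1)), Real.sqrt_pos.2 hp, ?_⟩
    rw [Real.sq_sqrt hp.le, div_mul_eq_mul_div, div_lt_iff₀ (by positivity)]
    have : 0 < (c - a ^ 2) * B := by positivity
    nlinarith
  obtain ⟨δ', hδ', hball'⟩ := Metric.isOpen_iff.1 hΩ 0 h0
  obtain ⟨δ, hδ, hδ1, hball⟩ : ∃ δ : ℝ, 0 < δ ∧ δ < 1 ∧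
      Metric.closedBall (0 : EuclideanSpace ℝ (Fin (M + 3))) δ ⊆ Ω := by
    refine ⟨min (δ' / 2) (1 / 2), by positivity, ?_, ?_⟩
    · exact (min_le_right _ _).trans_lt (by norm_num)
    · refine (Metric.closedBall_subset_ball ?_).trans hball'
      exact (min_le_left _ _).trans_lt (by linarith)
  set b : ℝ := 2 - ε * Real.log δ with hb
  have hlogδ : Real.log δ < 0 := Real.log_neg hδ hδ1
  have hb2 : 2 < b := by
    have := mul_pos_of_neg_of_neg (neg_lt_zero.2 hε) hlogδ
    linarith
  set g : ℝ → ℝ := fun t => Real.exp (-a * t) * η (ε * t + b) with hg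
  set gd : ℝ → ℝ := fun t =>
    Real.exp (-a * t) * (ε * deriv η (ε * t + b) - a * η (ε * t + b)) with hgd
  have hgsmooth : ContDiff ℝ (⊤ : ℕ∞) g := by
    rw [hg]
    exact (Real.contDiff_exp.comp (contDiff_const.mul contDiff_id)).mul
      (hη.comp ((contDiff_const.mul contDiff_id).add contDiff_const))
  have hgder : ∀ t, HasDerivAt g (gd t) t := by
    intro t
    have d1 : HasDerivAt (fun t : ℝ => Real.exp (-a * t)) (Real.exp (-a * t) * (-a)) t := by
      simpa using ((hasDerivAt_id t).const_mul (-a)).exp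
    have d0 : HasDerivAt (fun t : ℝ => ε * t + b) ε t := by
      simpa using ((hasDerivAt_id t).const_mul ε).add_const b
    have d2 : HasDerivAt (fun t : ℝ => η (ε * t + b)) (deriv η (ε * t + b) * ε) t :=
      HasDerivAt.comp t ((hη.differentiable (by simp)) (ε * t + b)).hasDerivAt d0
    refine (d1.mul d2).congr_deriv ?_
    simp only [gd]; ring
  set φ : EuclideanSpace ℝ (Fin (M + 3)) → ℝ := fun x => g (Real.log ‖x‖) with hφ
  have hφ0 : φ 0 = 0 := by
    simp only [hφ, hg, norm_zero, Real.log_zero, mul_zero, zero_add]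
    rw [hηz b (by rw [abs_of_pos] <;> linarith), mul_zero]
  have hsupp : Function.support φ ⊆ Metric.closedBall 0 δ := by
    intro x hx
    by_contra hx'
    apply hx
    have hx'' : δ < ‖x‖ := by simpa using hx'
    have hl : Real.log δ ≤ Real.log ‖x‖ := Real.log_le_log hδ hx''.le
    have := mul_le_mul_of_nonneg_left hl hε.le
    simp only [hφ, hg]
    rw [hηz _ (le_trans (by linarith) (le_abs_self _)), mul_zero]
  have hts : tsupport φ ⊆ Metric.closedBall 0 δ :=
    closure_minimal hsupp Metric.isClosed_closedBall
  have hnear : φ =ᶠ[nhds 0] fun _ => 0 := by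
    have : Metric.ball (0 : EuclideanSpace ℝ (Fin (M + 3))) (Real.exp ((-2 - b) / ε))
        ∈ nhds 0 := Metric.ball_mem_nhds _ (Real.exp_pos _)
    filter_upwards [this] with x hx
    by_cases hx0 : x = 0
    · rw [hx0, hφ0]
    · have hx' : ‖x‖ < Real.exp ((-2 - b) / ε) := by simpa using hx
      have hl : Real.log ‖x‖ < (-2 - b) / ε :=
        (Real.log_lt_iff_lt_exp (norm_pos_iff.2 hx0)).2 hx'
      rw [lt_div_iff₀ hε] at hl
      simp only [hφ, hg]
      rw [hηz _ (le_trans (by linarith) (neg_le_abs _)), mul_zero]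
  have hgrad : ∀ x, ‖gradient φ x‖ ^ 2 = gd (Real.log ‖x‖) ^ 2 / ‖x‖ ^ 2 := by
    intro x
    by_cases hx0 : x = 0
    · subst hx0
      have : fderiv ℝ φ 0 = 0 := by rw [hnear.fderiv_eq]; simp
      simp [gradient, this]
    · exact hardy_grad _ g x hx0 _ (hgder _)
  have hkey : (∫ x in Ω, ‖gradient φ x‖ ^ 2) < c * ∫ x in Ω, (φ x) ^ 2 / ‖x‖ ^ 2 := by
    rw [setIntegral_eq_integral_of_forall_compl_eq_zero,
      setIntegral_eq_integral_of_forall_compl_eq_zero]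
    · obtain ⟨K, hK, hKf⟩ := hardy_radial M
      simp only [hgrad]
      have r1 := hKf (fun t => gd t ^ 2)
      have r2 := hKf (fun t => g t ^ 2)
      have hexp : ∀ t, Real.exp (-a * t) ^ 2 * Real.exp (((M : ℝ) + 1) * t) = 1 := by
        intro t
        rw [← ha2, ← Real.exp_nat_mul, ← Real.exp_add, Real.exp_eq_one_iff]
        push_cast; ring
      have q1 : ∫ t, gd t ^ 2 * Real.exp (((M : ℝ) + 1) * t)
          = ε⁻¹ * (ε ^ 2 * A + a ^ 2 * B) := by
        rw [hA, hB, ← hardy_oneD η hη hηc a ε b hε]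
        congr 1; funext t
        simp only [hgd, mul_pow]
        linear_combination (ε * deriv η (ε * t + b) - a * η (ε * t + b)) ^ 2 * hexp t
      have q2 : ∫ t, g t ^ 2 * Real.exp (((M : ℝ) + 1) * t) = ε⁻¹ * B := by
        have s1 := Measure.integral_comp_mul_left (fun s => η (s + b) ^ 2) ε
        have s2 := integral_add_right_eq_self (μ := volume) (fun s => η s ^ 2) b
        rw [s2, abs_of_pos (inv_pos.2 hε), smul_eq_mul] at s1
        rw [hB, ← s1]
        congr 1; funext t
        simp only [hg, mul_pow]
        linear_combination η (ε * t + b) ^ 2 * hexp t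
      rw [q1] at r1
      rw [q2] at r2
      rw [r1]
      simp only [hφ]
      rw [r2]
      have hKe : 0 < K * ε⁻¹ := by positivity
      have : K * ε⁻¹ * (ε ^ 2 * A + a ^ 2 * B) < K * ε⁻¹ * (c * B) :=
        mul_lt_mul_of_pos_left (by linarith) hKe
      linarith
    · intro x hx
      have : φ x = 0 := by
        by_contra h
        exact hx (hball (hsupp h))
      simp [this]
    · intro x hx
      have : fderiv ℝ φ x = 0 := by
        by_contra h
        exact hx (hball (hts (support_fderiv_subset ℝ h)))
      simp [gradient, this]
  refine ⟨φ, ?_, ?_, hts.trans hball, ?_, hkey⟩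
  · rw [contDiff_iff_contDiffAt]
    intro x
    by_cases hx0 : x = 0
    · subst hx0
      exact contDiffAt_const.congr_of_eventuallyEq hnear
    · exact hgsmooth.contDiffAt.comp x
        ((contDiffAt_norm ℝ hx0).log (norm_ne_zero_iff.2 hx0))
  · exact HasCompactSupport.of_support_subset_isCompact (isCompact_closedBall 0 δ) hsupp
  · intro h
    rw [h] at hkey
    simp [gradient] at hkey
end

section
/- Let N ≥ 3. There exists a constant c_N > 0 depending only on N such that for every bounded open set Ω ⊆ ℝ^N and every test function φ on Ω, ∫_Ω ‖∇φ(x)‖² dx ≥ μ* ∫_Ω φ(x)²/‖x‖² dx + λ_Ω ∫_Ω φ(x)² dx, where λ_Ω = c_N · |Ω|^{−2/N} and |Ω| denotes the Lebesgue measure of Ω (improved Hardy–Poincaré inequality of Brezis–Vázquez). -/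
open MeasureTheory

lemma ihp_div {N : ℕ} (g : EuclideanSpace ℝ (Fin N) → ℝ) (hg : ContDiff ℝ 1 g)
    (hc : HasCompactSupport g) :
    ∫ x, ((N : ℝ) * g x + fderiv ℝ g x x) = 0 := by
  have hgc : Continuous g := hg.continuous
  have hdc : Continuous (fderiv ℝ g) := hg.continuous_fderiv (by simp)
  have hcd : HasCompactSupport (fderiv ℝ g) := hc.fderiv ℝ
  have hgi : Integrable g := hgc.integrable_of_hasCompactSupport hc
  have hdi : ∀ i : Fin N, Integrable
      (fun x : EuclideanSpace ℝ (Fin N) => x i * fderiv ℝ g x (EuclideanSpace.single i 1)) := by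
    intro i
    apply Continuous.integrable_of_hasCompactSupport
    · fun_prop
    · apply HasCompactSupport.mul_left
      exact hcd.comp_left (g := fun L : EuclideanSpace ℝ (Fin N) →L[ℝ] ℝ =>
        L (EuclideanSpace.single i 1)) (by simp)
  have hproj : ∀ (i : Fin N) (x : EuclideanSpace ℝ (Fin N)),
      fderiv ℝ (fun x : EuclideanSpace ℝ (Fin N) => x i) x (EuclideanSpace.single i 1) = 1 := by
    intro i x
    have : (fun x : EuclideanSpace ℝ (Fin N) => x i) =
      (EuclideanSpace.proj i : EuclideanSpace ℝ (Fin N) →L[ℝ] ℝ) := by ext; simp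
    rw [this, ContinuousLinearMap.fderiv]
    simp
  have h1 : ∀ i : Fin N, ∫ x : EuclideanSpace ℝ (Fin N),
      x i * fderiv ℝ g x (EuclideanSpace.single i 1) = - ∫ x, g x := by
    intro i
    have := integral_mul_fderiv_eq_neg_fderiv_mul_of_integrable (μ := volume)
      (f := fun x : EuclideanSpace ℝ (Fin N) => x i) (g := g) (v := EuclideanSpace.single i 1)
      (by simpa [hproj] using hgi) (hdi i)
      (by
        apply Continuous.integrable_of_hasCompactSupport
        · fun_prop
        · exact hc.mul_left)
      (fun x _ => by fun_prop)
      (fun x _ => (hg.differentiable (by simp)) x)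
    simpa [hproj] using this
  have h2 : ∀ x : EuclideanSpace ℝ (Fin N), fderiv ℝ g x x =
      ∑ i, x i * fderiv ℝ g x (EuclideanSpace.single i 1) := by
    intro x
    conv_lhs => arg 2; rw [← (EuclideanSpace.basisFun (Fin N) ℝ).sum_repr x]
    simp only [map_sum, map_smul, smul_eq_mul, EuclideanSpace.basisFun_repr, EuclideanSpace.basisFun_apply]
  simp_rw [h2]
  rw [integral_add (hgi.const_mul _) (integrable_finsetSum _ fun i _ => hdi i),
    integral_finsetSum _ (fun i _ => hdi i)]
  simp [h1, integral_const_mul]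

lemma ihp_alg (N s ε a b : ℝ) (hN : 3 ≤ N) (ha : 0 < a) (hb : 0 < b)
    (hε : 0 < ε) (has : a * (s + ε) = 1) :
    ((N-2)/2)^2 * (s * a^2) + (2 * b - 3 * s * b^2) ≤
      N * ((N-2)/2 * a + b) - 2 * s * ((N-2)/2 * a^2 + b^2) - ((N-2)/2 * a + b)^2 * s := by
  have h1 : a * s ≤ 1 := by nlinarith
  have h2 : s * a^2 ≤ a := by nlinarith
  nlinarith [mul_nonneg (mul_nonneg (by linarith : 0 ≤ N - 2) hb.le) (by linarith : 0 ≤ 1 - a * s),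
    mul_nonneg (mul_nonneg (by linarith : 0 ≤ N - 2) (by linarith : 0 ≤ N)) (by linarith : 0 ≤ a - s * a^2)]

noncomputable def ihpK (N : ℕ) (ε R : ℝ) (x : EuclideanSpace ℝ (Fin N)) : ℝ :=
  ((N:ℝ)-2)/2 * (‖x‖^2 + ε)⁻¹ + (R^2 + ‖x‖^2)⁻¹

lemma ihpK_contDiff (N : ℕ) (ε R : ℝ) (hε : 0 < ε) (hR : 0 < R) : ContDiff ℝ 1 (ihpK N ε R) := by
  unfold ihpK
  have h := contDiff_norm_sq ℝ (E := EuclideanSpace ℝ (Fin N)) (n := 1)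
  refine ContDiff.add (contDiff_const.mul (ContDiff.inv (h.add contDiff_const) ?_))
    (ContDiff.inv (contDiff_const.add h) ?_)
  · intro x; positivity
  · intro x; positivity

lemma ihpK_fderiv (N : ℕ) (ε R : ℝ) (hε : 0 < ε) (hR : 0 < R) (x : EuclideanSpace ℝ (Fin N)) :
    fderiv ℝ (ihpK N ε R) x x = - 2 * ‖x‖^2 * (((N:ℝ)-2)/2 * ((‖x‖^2 + ε)⁻¹)^2 + ((R^2 + ‖x‖^2)⁻¹)^2) := by
  have h : HasFDerivAt (fun y : EuclideanSpace ℝ (Fin N) => ‖y‖^2) (2 • innerSL ℝ x) x :=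
    (hasStrictFDerivAt_norm_sq x).hasFDerivAt
  have ha : HasFDerivAt (fun y : EuclideanSpace ℝ (Fin N) => (‖y‖^2 + ε)⁻¹) _ x :=
    (hasDerivAt_inv (x := ‖x‖^2 + ε) (by positivity)).comp_hasFDerivAt x (h.add_const ε)
  have hb : HasFDerivAt (fun y : EuclideanSpace ℝ (Fin N) => (R^2 + ‖y‖^2)⁻¹) _ x :=
    (hasDerivAt_inv (x := R^2 + ‖x‖^2) (by positivity)).comp_hasFDerivAt x (h.const_add (R^2))
  have hK : HasFDerivAt (ihpK N ε R) _ x := (ha.const_mul (((N:ℝ)-2)/2)).add hb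
  rw [hK.fderiv]
  simp
  ring

lemma ihp_energy {N : ℕ} (hN : 3 ≤ N) (ε R : ℝ) (hε : 0 < ε) (hR : 0 < R)
    (φ : EuclideanSpace ℝ (Fin N) → ℝ) (hφ : ContDiff ℝ 1 φ) (hc : HasCompactSupport φ) :
    ((N:ℝ)-2)/2 * (((N:ℝ)-2)/2) * (∫ x, ‖x‖^2 * ((‖x‖^2 + ε)⁻¹)^2 * φ x ^ 2)
      + (∫ x, (2 * (R^2 + ‖x‖^2)⁻¹ - 3 * ‖x‖^2 * ((R^2 + ‖x‖^2)⁻¹)^2) * φ x ^ 2)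
      + (∫ x, ‖gradient φ x + (ihpK N ε R x * φ x) • x‖^2) ≤ ∫ x, ‖gradient φ x‖^2 := by
  have hK := ihpK_contDiff N ε R hε hR
  have hKc := hK.continuous
  have hφc := hφ.continuous
  have hgc : Continuous (gradient φ) := by
    unfold gradient
    exact (LinearIsometryEquiv.continuous _).comp (hφ.continuous_fderiv (by simp))
  have hgs : HasCompactSupport (gradient φ) := by
    unfold gradient
    exact (hc.fderiv ℝ).comp_left (by simp)
  have hn1 : ∀ x : EuclideanSpace ℝ (Fin N), ‖x‖^2 + ε ≠ 0 := fun x => by positivity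
  have hn2 : ∀ x : EuclideanSpace ℝ (Fin N), R^2 + ‖x‖^2 ≠ 0 := fun x => by positivity
  have c1 : Continuous (fun x : EuclideanSpace ℝ (Fin N) => (‖x‖^2 + ε)⁻¹) :=
    Continuous.inv₀ (by fun_prop) hn1
  have c2 : Continuous (fun x : EuclideanSpace ℝ (Fin N) => (R^2 + ‖x‖^2)⁻¹) :=
    Continuous.inv₀ (by fun_prop) hn2
  have hs2 : HasCompactSupport (fun x => φ x ^ 2) := hc.comp_left (g := fun t : ℝ => t^2) (by simp)
  have i1 : Integrable (fun x => ‖x‖^2 * ((‖x‖^2 + ε)⁻¹)^2 * φ x ^ 2) :=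
    Continuous.integrable_of_hasCompactSupport (by fun_prop) hs2.mul_left
  have i2 : Integrable (fun x => (2 * (R^2 + ‖x‖^2)⁻¹ - 3 * ‖x‖^2 * ((R^2 + ‖x‖^2)⁻¹)^2) * φ x ^ 2) :=
    Continuous.integrable_of_hasCompactSupport (by fun_prop) hs2.mul_left
  have i3 : Integrable (fun x => ‖gradient φ x + (ihpK N ε R x * φ x) • x‖^2) := by
    apply Continuous.integrable_of_hasCompactSupport (by fun_prop)
    refine (hgs.add (f' := fun x => (ihpK N ε R x * φ x) • x) ?_).comp_left (g := fun t => ‖t‖^2) (by simp)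
    exact (hc.mul_left (f := ihpK N ε R)).smul_right
  have i4 : Integrable (fun x => ‖gradient φ x‖^2) := by
    apply Continuous.integrable_of_hasCompactSupport (by fun_prop)
    exact hgs.comp_left (g := fun t => ‖t‖^2) (by simp)
  set g : EuclideanSpace ℝ (Fin N) → ℝ := fun x => ihpK N ε R x * φ x ^ 2 with hg
  have hgC : ContDiff ℝ 1 g := hK.mul (hφ.pow 2)
  have hgS : HasCompactSupport g := hs2.mul_left
  have h0 := ihp_div g hgC hgS
  have i5 : Integrable (fun x => (N:ℝ) * g x + fderiv ℝ g x x) := by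
    apply Continuous.integrable_of_hasCompactSupport
    · have := hgC.continuous_fderiv (by simp)
      have := hgC.continuous
      fun_prop
    · apply HasCompactSupport.add
      · exact hgS.mul_left
      · refine (hgS.fderiv ℝ).mono ?_
        intro x hx
        simp only [Function.mem_support] at hx ⊢
        intro h; apply hx; simp [h]
  have key : ∀ x, ((N:ℝ)-2)/2 * (((N:ℝ)-2)/2) * (‖x‖^2 * ((‖x‖^2 + ε)⁻¹)^2 * φ x ^ 2)
      + (2 * (R^2 + ‖x‖^2)⁻¹ - 3 * ‖x‖^2 * ((R^2 + ‖x‖^2)⁻¹)^2) * φ x ^ 2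
      + ‖gradient φ x + (ihpK N ε R x * φ x) • x‖^2
      ≤ ‖gradient φ x‖^2 + ((N:ℝ) * g x + fderiv ℝ g x x) := by
    intro x
    have hd : fderiv ℝ g x x = fderiv ℝ (ihpK N ε R) x x * φ x ^ 2
        + 2 * ihpK N ε R x * φ x * fderiv ℝ φ x x := by
      have h1 := (hK.differentiable (by simp) x).hasFDerivAt
      have h2 := (hφ.differentiable (by simp) x).hasFDerivAt
      have h3 : HasFDerivAt g _ x := h1.mul (h2.pow 2)
      rw [h3.fderiv]
      simp
      ring
    rw [hd, ihpK_fderiv N ε R hε hR, norm_add_sq_real, norm_smul, mul_pow, real_inner_smul_right,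
      inner_gradient_left]
    have halg := ihp_alg N (‖x‖^2) ε ((‖x‖^2 + ε)⁻¹) ((R^2 + ‖x‖^2)⁻¹) (by exact_mod_cast hN)
      (by positivity) (by positivity) hε (inv_mul_cancel₀ (hn1 x))
    have := mul_le_mul_of_nonneg_right halg (sq_nonneg (φ x))
    simp only [hg, Real.norm_eq_abs, sq_abs]
    unfold ihpK
    nlinarith [this]
  have i12 : Integrable (fun x => ((N:ℝ)-2)/2 * (((N:ℝ)-2)/2) * (‖x‖^2 * ((‖x‖^2 + ε)⁻¹)^2 * φ x ^ 2)
      + (2 * (R^2 + ‖x‖^2)⁻¹ - 3 * ‖x‖^2 * ((R^2 + ‖x‖^2)⁻¹)^2) * φ x ^ 2) :=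
    (i1.const_mul _).add i2
  have := integral_mono (((i1.const_mul (((N:ℝ)-2)/2 * (((N:ℝ)-2)/2))).add i2).add i3) (i4.add i5) key
  simp only [Pi.add_apply] at this
  rw [integral_add i12 i3, integral_add (i1.const_mul _) i2, integral_add i4 i5,
    h0, integral_const_mul] at this
  simpa using this

lemma ihp_segment {N : ℕ} (φ : EuclideanSpace ℝ (Fin N) → ℝ) (hφ : ContDiff ℝ 1 φ)
    (x h : EuclideanSpace ℝ (Fin N)) (h0 : φ (x + h) = 0) :
    φ x ^ 2 ≤ ∫ t in (0:ℝ)..1, ‖h‖^2 * ‖gradient φ (x + t • h)‖^2 := by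
  have hdc := hφ.continuous_fderiv (by simp)
  have hgc : Continuous (gradient φ) := by
    unfold gradient
    exact (LinearIsometryEquiv.continuous _).comp hdc
  set f : ℝ → ℝ := fun t => fderiv ℝ φ (x + t • h) h with hf
  have hfc : Continuous f := by fun_prop
  have hd : ∀ t : ℝ, HasDerivAt (fun t : ℝ => φ (x + t • h)) (f t) t := by
    intro t
    have h1 : HasDerivAt (fun t : ℝ => x + t • h) h t := by
      simpa using ((hasDerivAt_id t).smul_const h).const_add x
    exact ((hφ.differentiable (by simp) (x + t • h)).hasFDerivAt).comp_hasDerivAt t h1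
  have hm : ∫ t in (0:ℝ)..1, f t = - φ x := by
    rw [intervalIntegral.integral_eq_sub_of_hasDerivAt (fun t _ => hd t) (hfc.intervalIntegrable _ _)]
    simp [h0]
  have hpos : 0 ≤ ∫ t in (0:ℝ)..1, (f t ^ 2 + (2 * φ x) * f t + φ x ^ 2) := by
    apply intervalIntegral.integral_nonneg (by norm_num)
    intro t _
    nlinarith [sq_nonneg (f t + φ x)]
  rw [intervalIntegral.integral_add (by apply Continuous.intervalIntegrable; fun_prop)
      (by apply Continuous.intervalIntegrable; fun_prop),
    intervalIntegral.integral_add (by apply Continuous.intervalIntegrable; fun_prop)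
      (by apply Continuous.intervalIntegrable; fun_prop),
    intervalIntegral.integral_const_mul, hm] at hpos
  simp only [intervalIntegral.integral_const, sub_zero, one_smul] at hpos
  have hle : ∫ t in (0:ℝ)..1, f t ^ 2 ≤ ∫ t in (0:ℝ)..1, ‖h‖^2 * ‖gradient φ (x + t • h)‖^2 := by
    apply intervalIntegral.integral_mono_on (by norm_num)
      (by apply Continuous.intervalIntegrable; fun_prop)
      (by apply Continuous.intervalIntegrable; fun_prop)
    intro t _
    have h1 : |f t| ≤ ‖gradient φ (x + t • h)‖ * ‖h‖ := by
      simp only [hf]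
      rw [← inner_gradient_left]
      exact abs_real_inner_le_norm _ _
    have := pow_le_pow_left₀ (abs_nonneg _) h1 2
    rw [sq_abs] at this
    linarith [mul_pow ‖gradient φ (x + t • h)‖ ‖h‖ 2]
  nlinarith

lemma ihp_trans_h {N : ℕ} (Ω : Set (EuclideanSpace ℝ (Fin N)))
    (R ρ : ℝ) (hρ : 0 < ρ) (hρR : ρ ≤ R / 2)
    (φ : EuclideanSpace ℝ (Fin N) → ℝ) (hφ : ContDiff ℝ 1 φ) (hz : ∀ x, x ∉ Ω → φ x = 0)
    (h : EuclideanSpace ℝ (Fin N)) (hh : h ∈ Metric.ball 0 ρ) :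
    ∫⁻ x, ({x | R ≤ ‖x‖}.indicator (fun x => ENNReal.ofReal (φ x ^ 2)) x) *
        (Ωᶜ.indicator 1 (x + h)) ≤
      ENNReal.ofReal (ρ^2) *
        ∫⁻ y, {y | R / 2 ≤ ‖y‖}.indicator (fun y => ENNReal.ofReal (‖gradient φ y‖^2)) y := by
  have hgc : Continuous (gradient φ) := by
    unfold gradient
    exact (LinearIsometryEquiv.continuous _).comp (hφ.continuous_fderiv (by simp))
  set F : EuclideanSpace ℝ (Fin N) → ENNReal :=
    {y | R / 2 ≤ ‖y‖}.indicator (fun y => ENNReal.ofReal (‖gradient φ y‖^2)) with hF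
  have hFm : Measurable F := by
    apply Measurable.indicator
    · exact (by fun_prop : Continuous fun y => ‖gradient φ y‖^2).measurable.ennreal_ofReal
    · exact measurableSet_le measurable_const measurable_norm
  have hhn : ‖h‖ < ρ := by simpa using hh
  have hp : ∀ x, ({x | R ≤ ‖x‖}.indicator (fun x => ENNReal.ofReal (φ x ^ 2)) x) *
        (Ωᶜ.indicator 1 (x + h)) ≤
        ENNReal.ofReal (ρ^2) * ∫⁻ t in Set.Ioc (0:ℝ) 1, F (x + t • h) := by
    intro x
    by_cases hx : R ≤ ‖x‖
    swap
    · simp [hx]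
    by_cases hxh : x + h ∈ Ω
    · simp [hxh]
    have h1 := ihp_segment φ hφ x h (hz _ hxh)
    simp only [Set.indicator, Set.mem_ofPred_eq, hx, Set.mem_compl_iff, hxh, if_true, not_false_eq_true,
      Pi.one_apply, mul_one]
    rw [intervalIntegral.integral_of_le (by norm_num)] at h1
    refine (ENNReal.ofReal_le_ofReal h1).trans ?_
    rw [ofReal_integral_eq_lintegral_ofReal]
    · rw [← lintegral_const_mul _ (by fun_prop)]
      apply setLIntegral_mono (by fun_prop)
      intro t ht
      have hmem : R / 2 ≤ ‖x + t • h‖ := by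
        have h2 : ‖t • h‖ ≤ ρ := by
          rw [norm_smul, Real.norm_eq_abs, abs_of_pos ht.1]
          nlinarith [ht.2, ht.1, norm_nonneg h]
        have h3 : ‖x‖ ≤ ‖x + t • h‖ + ‖t • h‖ := by
          simpa using norm_sub_le (x + t • h) (t • h)
        linarith
      rw [hF, Set.indicator_of_mem (by exact hmem), ← ENNReal.ofReal_mul (by positivity)]
      apply ENNReal.ofReal_le_ofReal
      gcongr
    · exact (Continuous.integrableOn_Ioc (by fun_prop))
    · exact Filter.Eventually.of_forall fun t => by positivity
  refine (lintegral_mono hp).trans ?_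
  rw [lintegral_const_mul' _ _ ENNReal.ofReal_ne_top]
  refine mul_le_mul_right ?_ _
  rw [lintegral_lintegral_swap (by
    apply Measurable.aemeasurable
    exact hFm.comp (by fun_prop))]
  simp only [lintegral_add_right_eq_self F]
  simp

lemma ihp_trans {N : ℕ} (Ω : Set (EuclideanSpace ℝ (Fin N))) (hΩ : MeasurableSet Ω)
    (R ρ : ℝ) (hρ : 0 < ρ) (hρR : ρ ≤ R / 2)
    (hvol : 2 * volume Ω ≤ volume (Metric.ball (0 : EuclideanSpace ℝ (Fin N)) ρ))
    (φ : EuclideanSpace ℝ (Fin N) → ℝ) (hφ : ContDiff ℝ 1 φ) (hz : ∀ x, x ∉ Ω → φ x = 0) :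
    ∫⁻ x, {x | R ≤ ‖x‖}.indicator (fun x => ENNReal.ofReal (φ x ^ 2)) x ≤
      2 * (ENNReal.ofReal (ρ^2) *
        ∫⁻ y, {y | R / 2 ≤ ‖y‖}.indicator (fun y => ENNReal.ofReal (‖gradient φ y‖^2)) y) := by
  set J := ENNReal.ofReal (ρ^2) *
        ∫⁻ y, {y | R / 2 ≤ ‖y‖}.indicator (fun y => ENNReal.ofReal (‖gradient φ y‖^2)) y with hJ
  set u := {x | R ≤ ‖x‖}.indicator (fun x => ENNReal.ofReal (φ x ^ 2)) with hu
  set B := Metric.ball (0 : EuclideanSpace ℝ (Fin N)) ρ with hB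
  have hBpos : volume B ≠ 0 := (Metric.measure_ball_pos volume 0 hρ).ne'
  have hBfin : volume B ≠ ⊤ := measure_ball_lt_top.ne
  have hum : Measurable u := by
    apply Measurable.indicator
    · have := hφ.continuous
      exact (by fun_prop : Continuous fun y => φ y^2).measurable.ennreal_ofReal
    · exact measurableSet_le measurable_const measurable_norm
  have h1 : ∫⁻ h in B, ∫⁻ x, u x * (Ωᶜ.indicator 1 (x + h)) ≤ J * volume B := by
    calc _ ≤ ∫⁻ h in B, J := by
          apply setLIntegral_mono (by fun_prop)
          intro h hh
          exact ihp_trans_h Ω R ρ hρ hρR φ hφ hz h hh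
      _ = _ := by simp
  have hone : Measurable (Ωᶜ.indicator (1 : EuclideanSpace ℝ (Fin N) → ENNReal)) :=
    measurable_one.indicator hΩ.compl
  rw [lintegral_lintegral_swap (by
    apply Measurable.aemeasurable
    exact (hum.comp measurable_snd).mul (hone.comp (by fun_prop)))] at h1
  have h2 : ∫⁻ x, u x * (volume B / 2) ≤ ∫⁻ x, ∫⁻ h in B, u x * (Ωᶜ.indicator 1 (x + h)) := by
    apply lintegral_mono
    intro x
    show u x * (volume B / 2) ≤ ∫⁻ h in B, u x * (Ωᶜ.indicator 1 (x + h))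
    have hmx : Measurable (fun h => Ωᶜ.indicator (1 : EuclideanSpace ℝ (Fin N) → ENNReal) (x + h)) :=
      hone.comp (by fun_prop)
    rw [lintegral_const_mul _ hmx]
    refine mul_le_mul_right ?_ _
    have h3 : ∫⁻ h in B, (Ω.indicator (1 : EuclideanSpace ℝ (Fin N) → ENNReal) (x + h)) ≤ volume Ω := by
      calc _ ≤ ∫⁻ h, (Ω.indicator (1 : EuclideanSpace ℝ (Fin N) → ENNReal) (x + h)) :=
            setLIntegral_le_lintegral _ _
        _ = ∫⁻ h, (Ω.indicator (1 : EuclideanSpace ℝ (Fin N) → ENNReal) h) :=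
            lintegral_add_left_eq_self _ _
        _ = volume Ω := lintegral_indicator_one hΩ
    have h4 : volume B = (∫⁻ h in B, (Ω.indicator (1 : EuclideanSpace ℝ (Fin N) → ENNReal) (x + h))) +
        (∫⁻ h in B, (Ωᶜ.indicator (1 : EuclideanSpace ℝ (Fin N) → ENNReal) (x + h))) := by
      have hmx' : Measurable (fun h => Ω.indicator (1 : EuclideanSpace ℝ (Fin N) → ENNReal) (x + h)) :=
        (measurable_one.indicator hΩ).comp (by fun_prop)
      rw [← lintegral_add_left hmx']
      have : ∀ y, Ω.indicator (1 : EuclideanSpace ℝ (Fin N) → ENNReal) y + Ωᶜ.indicator 1 y = 1 := by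
        intro y
        exact congrFun (Set.indicator_self_add_compl Ω 1) y
      simp [this]
    have h5 : volume Ω ≤ volume B / 2 := by
      rw [ENNReal.le_div_iff_mul_le (by simp) (by simp), mul_comm]
      exact hvol
    have h6 : volume B / 2 + volume B / 2 ≤ volume B / 2 +
        ∫⁻ h in B, (Ωᶜ.indicator (1 : EuclideanSpace ℝ (Fin N) → ENNReal) (x + h)) := by
      rw [ENNReal.add_halves]
      conv_lhs => rw [h4]
      exact add_le_add (h3.trans h5) le_rfl
    exact (ENNReal.add_le_add_iff_left (ENNReal.div_ne_top hBfin (by simp))).1 h6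
  rw [lintegral_mul_const _ hum] at h2
  have h7 := h2.trans h1
  have h8 : (∫⁻ x, u x) * volume B ≤ 2 * J * volume B := by
    calc (∫⁻ x, u x) * volume B = 2 * ((∫⁻ x, u x) * (volume B / 2)) := by
          rw [mul_left_comm, ENNReal.mul_div_cancel (by simp) (by simp)]
      _ ≤ 2 * (J * volume B) := by gcongr
      _ = _ := by ring
  exact (ENNReal.mul_le_mul_iff_left hBpos hBfin).1 h8

lemma ihp_real_trans {N : ℕ} (Ω : Set (EuclideanSpace ℝ (Fin N))) (hΩ : MeasurableSet Ω)
    (R ρ : ℝ) (hρ : 0 < ρ) (hρR : ρ ≤ R / 2)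
    (hvol : 2 * volume Ω ≤ volume (Metric.ball (0 : EuclideanSpace ℝ (Fin N)) ρ))
    (φ : EuclideanSpace ℝ (Fin N) → ℝ) (hφ : ContDiff ℝ 1 φ) (hz : ∀ x, x ∉ Ω → φ x = 0)
    (j1 : Integrable (fun x => φ x ^ 2)) (j2 : Integrable (fun x => ‖gradient φ x‖ ^ 2)) :
    ∫ x, {x | R ≤ ‖x‖}.indicator (fun x => φ x ^ 2) x ≤
      2 * (ρ^2 * ∫ y, {y | R / 2 ≤ ‖y‖}.indicator (fun y => ‖gradient φ y‖^2) y) := by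
  have hm : ∀ r : ℝ, MeasurableSet {x : EuclideanSpace ℝ (Fin N) | r ≤ ‖x‖} := fun r =>
    measurableSet_le measurable_const measurable_norm
  have hconv : ∀ (r : ℝ) (f : EuclideanSpace ℝ (Fin N) → ℝ), (∀ x, 0 ≤ f x) → Integrable f →
      ∫⁻ x, {x | r ≤ ‖x‖}.indicator (fun x => ENNReal.ofReal (f x)) x =
      ENNReal.ofReal (∫ x, {x | r ≤ ‖x‖}.indicator f x) := by
    intro r f hf hi
    rw [ofReal_integral_eq_lintegral_ofReal (hi.indicator (hm r))
      (Filter.Eventually.of_forall fun x => Set.indicator_nonneg (fun x _ => hf x) x)]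
    apply lintegral_congr
    intro x
    by_cases hx : r ≤ ‖x‖ <;> simp [Set.indicator, hx]
  have h22 : ∀ y : ℝ, 2 * ENNReal.ofReal y = ENNReal.ofReal (2 * y) := by
    intro y
    rw [ENNReal.ofReal_mul (by norm_num)]
    simp
  have h := ihp_trans Ω hΩ R ρ hρ hρR hvol φ hφ hz
  rw [hconv R (fun x => φ x ^ 2) (fun x => sq_nonneg _) j1,
    hconv (R/2) (fun x => ‖gradient φ x‖ ^ 2) (fun x => sq_nonneg _) j2,
    ← ENNReal.ofReal_mul (by positivity),
    h22] at h
  refine (ENNReal.ofReal_le_ofReal_iff ?_).1 h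
  have : 0 ≤ ∫ y, {y | R / 2 ≤ ‖y‖}.indicator (fun y => ‖gradient φ y‖^2) y :=
    integral_nonneg fun x => Set.indicator_nonneg (fun x _ => sq_nonneg _) x
  positivity

lemma ihpK_bound {N : ℕ} (hN : 3 ≤ N) (ε R : ℝ) (hε : 0 < ε) (hR : 0 < R)
    (x : EuclideanSpace ℝ (Fin N)) (hx : R / 2 ≤ ‖x‖) : (ihpK N ε R x)^2 * ‖x‖^2 ≤ N^2 / R^2 := by
  have hN' : (3:ℝ) ≤ N := by exact_mod_cast hN
  have hxp : 0 < ‖x‖ := by linarith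
  have h1 : (‖x‖^2 + ε)⁻¹ * ‖x‖ ≤ 2 / R := by
    rw [inv_mul_le_iff₀ (by positivity), mul_div_assoc', le_div_iff₀ hR]
    nlinarith
  have h2 : (R^2 + ‖x‖^2)⁻¹ * ‖x‖ ≤ 1 / R := by
    rw [inv_mul_le_iff₀ (by positivity), mul_div_assoc', le_div_iff₀ hR]
    nlinarith [sq_nonneg (R - ‖x‖)]
  have h3 : ihpK N ε R x * ‖x‖ ≤ N / R := by
    unfold ihpK
    have := mul_le_mul_of_nonneg_left h1 (by linarith : 0 ≤ ((N:ℝ)-2)/2)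
    have e : (N:ℝ) / R = ((N:ℝ)-2)/2 * (2 / R) + 2 * (1 / R) := by field_simp; ring
    have : 0 < 1 / R := by positivity
    rw [e]
    nlinarith
  have h4 : 0 ≤ ihpK N ε R x * ‖x‖ := by
    unfold ihpK
    have : 0 ≤ ((N:ℝ)-2)/2 := by linarith
    positivity
  rw [← mul_pow, ← div_pow]
  exact pow_le_pow_left₀ h4 h3 2

lemma ihp_V_bound (R s : ℝ) (hR : 0 < R) (hs : 0 ≤ s) :
    1 / (4 * R^2) - (if R^2 ≤ s then 3 / (4 * R^2) else 0) ≤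
      2 * (R^2 + s)⁻¹ - 3 * s * ((R^2 + s)⁻¹)^2 := by
  have e : 2 * (R^2 + s)⁻¹ - 3 * s * ((R^2 + s)⁻¹)^2 = (2 * R^2 - s) / (R^2 + s)^2 := by
    field_simp
    ring
  rw [e]
  have hR2 : 0 < R^2 := by positivity
  split_ifs with h
  · have : 1 / (4 * R^2) - 3 / (4 * R^2) = (-1) / (2 * R^2) := by field_simp; ring
    rw [this, div_le_div_iff₀ (by positivity) (by positivity)]
    nlinarith [sq_nonneg (R^2 - s), sq_nonneg s]
  · push Not at h
    rw [sub_zero, div_le_div_iff₀ (by positivity) (by positivity)]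
    nlinarith [mul_pos hR2 hR2, mul_nonneg hs (by linarith : 0 ≤ R^2 - s)]

lemma ihp_eps {N : ℕ} (hN : 3 ≤ N) (Ω : Set (EuclideanSpace ℝ (Fin N))) (hΩ : MeasurableSet Ω)
    (ρ ε : ℝ) (hρ : 0 < ρ) (hε : 0 < ε)
    (hvol : 2 * volume Ω ≤ volume (Metric.ball (0 : EuclideanSpace ℝ (Fin N)) ρ))
    (φ : EuclideanSpace ℝ (Fin N) → ℝ) (hφ : ContDiff ℝ 1 φ) (hc : HasCompactSupport φ)
    (hz : ∀ x, x ∉ Ω → φ x = 0) :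
    (((N:ℝ)-2)/2)^2 * (∫ x, ‖x‖^2 * ((‖x‖^2 + ε)⁻¹)^2 * φ x ^ 2)
      + 1 / (6 * (6 * N * ρ)^2) * (∫ x, φ x ^ 2) ≤ ∫ x, ‖gradient φ x‖^2 := by
  have hN' : (3:ℝ) ≤ N := by exact_mod_cast hN
  set R := 6 * N * ρ with hRdef
  have hR : 0 < R := by positivity
  have hρR : ρ ≤ R / 2 := by rw [hRdef]; nlinarith
  have hE := ihp_energy hN ε R hε hR φ hφ hc
  have hKc := (ihpK_contDiff N ε R hε hR).continuous
  have hφc := hφ.continuous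
  have hgc : Continuous (gradient φ) := by
    unfold gradient
    exact (LinearIsometryEquiv.continuous _).comp (hφ.continuous_fderiv (by simp))
  have hgs : HasCompactSupport (gradient φ) := by
    unfold gradient
    exact (hc.fderiv ℝ).comp_left (by simp)
  have c2 : Continuous (fun x : EuclideanSpace ℝ (Fin N) => (R^2 + ‖x‖^2)⁻¹) :=
    Continuous.inv₀ (by fun_prop) (fun x => by positivity)
  have hs2 : HasCompactSupport (fun x => φ x ^ 2) := hc.comp_left (g := fun t : ℝ => t^2) (by simp)
  have i0 : Integrable (fun x => φ x ^ 2) :=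
    Continuous.integrable_of_hasCompactSupport (by fun_prop) hs2
  have i2 : Integrable (fun x => (2 * (R^2 + ‖x‖^2)⁻¹ - 3 * ‖x‖^2 * ((R^2 + ‖x‖^2)⁻¹)^2) * φ x ^ 2) :=
    Continuous.integrable_of_hasCompactSupport (by fun_prop) hs2.mul_left
  have i3 : Integrable (fun x => ‖gradient φ x + (ihpK N ε R x * φ x) • x‖^2) := by
    apply Continuous.integrable_of_hasCompactSupport (by fun_prop)
    refine (hgs.add (f' := fun x => (ihpK N ε R x * φ x) • x) ?_).comp_left (g := fun t => ‖t‖^2) (by simp)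
    exact (hc.mul_left (f := ihpK N ε R)).smul_right
  have i4 : Integrable (fun x => ‖gradient φ x‖^2) := by
    apply Continuous.integrable_of_hasCompactSupport (by fun_prop)
    exact hgs.comp_left (g := fun t => ‖t‖^2) (by simp)
  have hm : ∀ r : ℝ, MeasurableSet {x : EuclideanSpace ℝ (Fin N) | r ≤ ‖x‖} := fun r =>
    measurableSet_le measurable_const measurable_norm
  have hD := ihp_real_trans Ω hΩ R ρ hρ hρR hvol φ hφ hz i0 i4
  have hV : 1 / (4 * R^2) * (∫ x, φ x ^ 2) -
      3 / (4 * R^2) * (∫ x, {x | R ≤ ‖x‖}.indicator (fun x => φ x ^ 2) x) ≤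
      ∫ x, (2 * (R^2 + ‖x‖^2)⁻¹ - 3 * ‖x‖^2 * ((R^2 + ‖x‖^2)⁻¹)^2) * φ x ^ 2 := by
    rw [← integral_const_mul, ← integral_const_mul,
      ← integral_sub (i0.const_mul _) ((i0.indicator (hm R)).const_mul _)]
    apply integral_mono ((i0.const_mul _).sub ((i0.indicator (hm R)).const_mul _)) i2
    intro x
    have h1 := mul_le_mul_of_nonneg_right (ihp_V_bound R (‖x‖^2) hR (by positivity)) (sq_nonneg (φ x))
    have h2 : R^2 ≤ ‖x‖^2 ↔ R ≤ ‖x‖ := pow_le_pow_iff_left₀ hR.le (norm_nonneg _) (by simp)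
    refine le_trans (le_of_eq ?_) h1
    by_cases hx : R ≤ ‖x‖
    · simp [Set.indicator, hx, h2]; ring
    · simp [Set.indicator, hx, h2]
  have hJ : ∫ y, {y | R / 2 ≤ ‖y‖}.indicator (fun y => ‖gradient φ y‖^2) y ≤
      2 * (∫ x, ‖gradient φ x + (ihpK N ε R x * φ x) • x‖^2) + 2 * (N^2 / R^2) * ∫ x, φ x ^ 2 := by
    rw [← integral_const_mul, ← integral_const_mul, ← integral_add (i3.const_mul _) (i0.const_mul _)]
    apply integral_mono (i4.indicator (hm _)) ((i3.const_mul _).add (i0.const_mul _))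
    intro x
    show _ ≤ 2 * ‖gradient φ x + (ihpK N ε R x * φ x) • x‖^2 + 2 * (N^2 / R^2) * φ x ^ 2
    by_cases hx : R / 2 ≤ ‖x‖
    · rw [Set.indicator_of_mem (by exact hx)]
      have h1 := mul_le_mul_of_nonneg_right (ihpK_bound hN ε R hε hR x hx) (sq_nonneg (φ x))
      have h2 : ‖(ihpK N ε R x * φ x) • x‖^2 = (ihpK N ε R x)^2 * ‖x‖^2 * φ x^2 := by
        rw [norm_smul, mul_pow, Real.norm_eq_abs, sq_abs]; ring
      have h3 : ‖gradient φ x‖ ≤ ‖gradient φ x + (ihpK N ε R x * φ x) • x‖ + ‖(ihpK N ε R x * φ x) • x‖ := by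
        simpa using norm_sub_le (gradient φ x + (ihpK N ε R x * φ x) • x) ((ihpK N ε R x * φ x) • x)
      have h4 := pow_le_pow_left₀ (norm_nonneg _) h3 2
      nlinarith [sq_nonneg (‖gradient φ x + (ihpK N ε R x * φ x) • x‖ - ‖(ihpK N ε R x * φ x) • x‖)]
    · rw [Set.indicator_of_notMem (by exact hx)]
      positivity
  have hI : 0 ≤ ∫ x, ‖gradient φ x + (ihpK N ε R x * φ x) • x‖^2 :=
    integral_nonneg fun x => sq_nonneg _
  set I := ∫ x, ‖gradient φ x + (ihpK N ε R x * φ x) • x‖^2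
  set P := ∫ x, φ x ^ 2
  set D := ∫ x, {x | R ≤ ‖x‖}.indicator (fun x => φ x ^ 2) x
  set J := ∫ y, {y | R / 2 ≤ ‖y‖}.indicator (fun y => ‖gradient φ y‖^2) y
  set W := ∫ x, (2 * (R^2 + ‖x‖^2)⁻¹ - 3 * ‖x‖^2 * ((R^2 + ‖x‖^2)⁻¹)^2) * φ x ^ 2
  have k1 : D ≤ 4 * ρ^2 * I + P / 9 := by
    have : ρ^2 * J ≤ ρ^2 * (2 * I + 2 * (N^2 / R^2) * P) := by gcongr
    have e : ρ^2 * (2 * I + 2 * (N^2 / R^2) * P) = 2 * ρ^2 * I + P / 18 := by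
      rw [hRdef]; field_simp; ring
    linarith
  have k2 : 3 / (4 * R^2) * D ≤ I + 1 / (12 * R^2) * P := by
    have h1 : 3 / (4 * R^2) * D ≤ 3 / (4 * R^2) * (4 * ρ^2 * I + P / 9) := by gcongr
    have e : 3 / (4 * R^2) * (4 * ρ^2 * I + P / 9) = (12 * (N:ℝ)^2)⁻¹ * I + 1 / (12 * R^2) * P := by
      rw [hRdef]; field_simp; ring
    have h2 : (12 * (N:ℝ)^2)⁻¹ * I ≤ 1 * I := by
      gcongr
      apply inv_le_one_of_one_le₀
      nlinarith
    linarith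
  have e3 : 1 / (6 * R^2) * P = 1 / (4 * R^2) * P - 1 / (12 * R^2) * P := by
    field_simp; ring
  rw [e3, sq (((N:ℝ)-2)/2)]
  linarith

open Filter Topology in
lemma ihp_full {N : ℕ} (hN : 3 ≤ N) (Ω : Set (EuclideanSpace ℝ (Fin N))) (hΩ : MeasurableSet Ω)
    (ρ : ℝ) (hρ : 0 < ρ)
    (hvol : 2 * volume Ω ≤ volume (Metric.ball (0 : EuclideanSpace ℝ (Fin N)) ρ))
    (φ : EuclideanSpace ℝ (Fin N) → ℝ) (hφ : ContDiff ℝ 1 φ) (hc : HasCompactSupport φ)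
    (hz : ∀ x, x ∉ Ω → φ x = 0) :
    (((N:ℝ)-2)/2)^2 * (∫ x, φ x ^ 2 / ‖x‖^2)
      + 1 / (6 * (6 * N * ρ)^2) * (∫ x, φ x ^ 2) ≤ ∫ x, ‖gradient φ x‖^2 := by
  have hφc := hφ.continuous
  have hfix := fun (ε : ℝ) (hε : 0 < ε) => ihp_eps hN Ω hΩ ρ ε hρ hε hvol φ hφ hc hz
  by_cases hi : Integrable (fun x => φ x ^ 2 / ‖x‖^2)
  · have hlim : Tendsto (fun n : ℕ => ∫ x, ‖x‖^2 * ((‖x‖^2 + 1 / ((n:ℝ) + 1))⁻¹)^2 * φ x ^ 2) atTop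
        (𝓝 (∫ x, φ x ^ 2 / ‖x‖^2)) := by
      apply tendsto_integral_of_dominated_convergence _ _ hi
      · intro n
        refine Filter.Eventually.of_forall fun x => ?_
        by_cases hx : x = 0
        · simp [hx]
        have hxp : 0 < ‖x‖^2 := by positivity
        have hnp : 0 < 1 / ((n:ℝ) + 1) := by positivity
        rw [Real.norm_of_nonneg (by positivity), div_eq_inv_mul (φ x ^ 2)]
        refine mul_le_mul_of_nonneg_right ?_ (sq_nonneg _)
        calc ‖x‖^2 * ((‖x‖^2 + 1 / ((n:ℝ) + 1))⁻¹)^2 ≤ ‖x‖^2 * ((‖x‖^2)⁻¹)^2 := by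
              have : (‖x‖^2 + 1 / ((n:ℝ) + 1))⁻¹ ≤ (‖x‖^2)⁻¹ := inv_anti₀ hxp (by linarith)
              gcongr
          _ = (‖x‖^2)⁻¹ := by field_simp
      · refine Filter.Eventually.of_forall fun x => ?_
        by_cases hx : x = 0
        · simp [hx]
        have hxp : ‖x‖^2 ≠ 0 := by positivity
        have h1 : Tendsto (fun n : ℕ => ‖x‖^2 + 1 / ((n:ℝ) + 1)) atTop (𝓝 (‖x‖^2 + 0)) :=
          tendsto_const_nhds.add tendsto_one_div_add_atTop_nhds_zero_nat
        rw [add_zero] at h1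
        have h2 := ((h1.inv₀ hxp).pow 2).const_mul (‖x‖^2) |>.mul_const (φ x ^ 2)
        convert h2 using 2
        field_simp
      · intro n
        apply Continuous.aestronglyMeasurable
        have : Continuous (fun x : EuclideanSpace ℝ (Fin N) => (‖x‖^2 + 1 / ((n:ℝ) + 1))⁻¹) :=
          Continuous.inv₀ (by fun_prop) (fun x => by positivity)
        fun_prop
    exact le_of_tendsto ((hlim.const_mul _).add_const _)
      (Filter.Eventually.of_forall fun n => hfix (1 / ((n:ℝ) + 1)) (by positivity))
  · rw [integral_undef hi]
    have h1 := hfix 1 one_pos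
    have h2 : 0 ≤ ∫ x, ‖x‖^2 * ((‖x‖^2 + 1)⁻¹)^2 * φ x ^ 2 := integral_nonneg fun x => by positivity
    have h3 := mul_nonneg (sq_nonneg (((N:ℝ)-2)/2)) h2
    linarith

theorem improved_hardy_poincare (N : ℕ) (hN : 3 ≤ N) :
    ∃ c : ℝ, 0 < c ∧
      ∀ Ω : Set (EuclideanSpace ℝ (Fin N)), IsOpen Ω → Bornology.IsBounded Ω →
        ∀ φ : EuclideanSpace ℝ (Fin N) → ℝ,
          ContDiff ℝ (⊤ : ℕ∞) φ → HasCompactSupport φ → tsupport φ ⊆ Ω →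
          (((N : ℝ) - 2) / 2) ^ 2 * (∫ x in Ω, (φ x) ^ 2 / ‖x‖ ^ 2) +
              c * (volume Ω).toReal ^ (-(2 : ℝ) / N) * (∫ x in Ω, (φ x) ^ 2) ≤
            ∫ x in Ω, ‖gradient φ x‖ ^ 2 := by
  have hN' : (3:ℝ) ≤ N := by exact_mod_cast hN
  have hN0 : (N:ℝ) ≠ 0 := by linarith
  set ω := (volume (Metric.ball (0 : EuclideanSpace ℝ (Fin N)) 1)).toReal with hω
  have hωfin : volume (Metric.ball (0 : EuclideanSpace ℝ (Fin N)) 1) ≠ ⊤ := measure_ball_lt_top.ne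
  have hωpos : 0 < ω := ENNReal.toReal_pos (Metric.measure_ball_pos volume 0 one_pos).ne' hωfin
  refine ⟨(2 / ω) ^ (-(2:ℝ) / N) / (216 * N^2), by positivity, ?_⟩
  intro Ω hΩ hb φ hφ hc hsup
  rcases Set.eq_empty_or_nonempty Ω with rfl | hne
  · simp
  have hφ1 : ContDiff ℝ 1 φ := hφ.of_le (by exact_mod_cast le_top)
  have hz : ∀ x, x ∉ Ω → φ x = 0 := fun x hx => image_eq_zero_of_notMem_tsupport fun h => hx (hsup h)
  have hgz : ∀ x, x ∉ Ω → gradient φ x = 0 := by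
    intro x hx
    have : fderiv ℝ φ x = 0 := by
      by_contra h
      exact hx (hsup (support_fderiv_subset ℝ h))
    simp [gradient, this]
  have hvfin : volume Ω ≠ ⊤ := hb.measure_lt_top.ne
  set v := (volume Ω).toReal with hv
  have hvpos : 0 < v := ENNReal.toReal_pos (hΩ.measure_pos volume hne).ne' hvfin
  set ρ := (2 / ω * v) ^ ((1:ℝ) / N) with hρdef
  have hbase : 0 < 2 / ω * v := by positivity
  have hρ : 0 < ρ := by positivity
  have hρN : ρ ^ N = 2 / ω * v := by
    rw [hρdef, ← Real.rpow_natCast, ← Real.rpow_mul hbase.le, one_div_mul_cancel hN0, Real.rpow_one]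
  have hρ2 : (ρ^2)⁻¹ = (2 / ω) ^ (-(2:ℝ) / N) * v ^ (-(2:ℝ) / N) := by
    rw [← Real.mul_rpow (by positivity) hvpos.le, hρdef, ← Real.rpow_natCast, ← Real.rpow_mul hbase.le,
      ← Real.rpow_neg hbase.le]
    congr 1
    push_cast
    ring
  have hvol : 2 * volume Ω ≤ volume (Metric.ball (0 : EuclideanSpace ℝ (Fin N)) ρ) := by
    rw [Measure.addHaar_ball_of_pos volume _ hρ, finrank_euclideanSpace_fin, hρN,
      ← ENNReal.ofReal_toReal hvfin, ← ENNReal.ofReal_toReal hωfin, ← hv, ← hω,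
      ← ENNReal.ofReal_mul hbase.le, show (2 : ENNReal) = ENNReal.ofReal 2 by simp,
      ← ENNReal.ofReal_mul (by positivity)]
    apply ENNReal.ofReal_le_ofReal
    apply le_of_eq
    field_simp
  have key := ihp_full hN Ω hΩ.measurableSet ρ hρ hvol φ hφ1 hc hz
  rw [setIntegral_eq_integral_of_forall_compl_eq_zero (fun x hx => by simp [hz x hx]),
    setIntegral_eq_integral_of_forall_compl_eq_zero (fun x hx => by simp [hz x hx]),
    setIntegral_eq_integral_of_forall_compl_eq_zero (fun x hx => by simp [hgz x hx])]
  have e : (2 / ω) ^ (-(2:ℝ) / N) / (216 * N^2) * v ^ (-(2:ℝ) / N) = 1 / (6 * (6 * N * ρ)^2) := by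
    rw [div_mul_eq_mul_div, ← hρ2]
    field_simp
    norm_num
  rw [e]
  exact key
end

section
/- Let N ≥ 3, let Ω ⊆ ℝ^N be a bounded open set, and let 1 ≤ q < 2. Then there exists a constant C = C(q, Ω) > 0 such that for every test function φ on Ω, ∫_Ω ‖∇φ(x)‖² dx − μ* ∫_Ω φ(x)²/‖x‖² dx ≥ C · ( ∫_Ω ( |φ(x)|^q + ‖∇φ(x)‖^q ) dx )^{2/q} (improved Hardy–Poincaré inequality with W^{1,q}-norm). -/
open MeasureTheory
section
open Set
theorem hd_base (N : ℕ) (hN : 3 ≤ N) (R : ℝ) :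
    IntegrableOn (fun x : EuclideanSpace ℝ (Fin N) => (‖x‖^2)⁻¹) (Metric.ball 0 R) := by
  have : Nontrivial (EuclideanSpace ℝ (Fin N)) := by
    have : Nonempty (Fin N) := ⟨⟨0, by omega⟩⟩
    infer_instance
  rw [← integrable_indicator_iff Metric.isOpen_ball.measurableSet]
  have h := integrable_fun_norm_addHaar (E := EuclideanSpace ℝ (Fin N)) (μ := volume)
    (f := (Iio R).indicator (fun y : ℝ => (y^2)⁻¹))
  have e : (Metric.ball 0 R).indicator (fun x : EuclideanSpace ℝ (Fin N) => (‖x‖^2)⁻¹)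
      = fun x => (Iio R).indicator (fun y : ℝ => (y^2)⁻¹) ‖x‖ := by
    funext x
    simp [indicator]
  rw [e, h]
  have h2 : IntegrableOn (fun y : ℝ => (Iio R).indicator (fun y => y^(N-3)) y) (Ioi 0) := by
    have : IntegrableOn (fun y : ℝ => y^(N-3)) (Ioo 0 R) :=
      (((continuous_pow (N-3)).continuousOn).integrableOn_Icc).mono_set Ioo_subset_Icc_self
    change Integrable _ _
    rw [integrable_indicator_iff measurableSet_Iio]
    change Integrable _ _
    rw [Measure.restrict_restrict measurableSet_Iio, inter_comm, Ioi_inter_Iio]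
    exact this
  refine h2.congr_fun ?_ measurableSet_Ioi
  intro y hy
  have hy : 0 < y := hy
  by_cases hR : y < R
  · simp only [indicator, mem_Iio, hR, if_true, finrank_euclideanSpace, Fintype.card_fin, smul_eq_mul]
    have : N - 1 = (N - 3) + 2 := by omega
    rw [this, pow_add]; field_simp
  · simp [indicator, hR]

/-- weighted integrability -/
theorem hd_int (N : ℕ) (hN : 3 ≤ N) (s : ℝ) (hs : 0 ≤ s)
    (g : EuclideanSpace ℝ (Fin N) → ℝ) (hg : Continuous g) (hc : HasCompactSupport g) :
    Integrable (fun x => g x * (‖x‖^s * (‖x‖^2)⁻¹)) := by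
  obtain ⟨R, hR⟩ := hc.isCompact.isBounded.subset_ball 0
  have h1 := hd_base N hN R
  have hk : Continuous (fun x => g x * ‖x‖^s) :=
    hg.mul (continuous_norm.rpow_const (fun x => Or.inr hs))
  have hkc : HasCompactSupport (fun x => g x * ‖x‖^s) := hc.mul_right
  obtain ⟨M, hM⟩ := hk.bounded_above_of_compact_support hkc
  rw [← integrable_indicator_iff Metric.isOpen_ball.measurableSet] at h1
  have h2 := h1.bdd_mul (c := M) hk.aestronglyMeasurable (Filter.Eventually.of_forall hM)
  refine h2.congr (Filter.Eventually.of_forall fun x => ?_)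
  by_cases hx : x ∈ Metric.ball (0 : EuclideanSpace ℝ (Fin N)) R
  · simp [indicator_of_mem hx, mul_assoc]
  · have : g x = 0 := image_eq_zero_of_notMem_tsupport (fun h => hx (hR h))
    simp [this]

theorem hd_ident (N : ℕ) (hN : 3 ≤ N) (s : ℝ) (hs : 0 ≤ s)
    (ψ : EuclideanSpace ℝ (Fin N) → ℝ) (hψ : ContDiff ℝ 1 ψ) (hc : HasCompactSupport ψ) :
    ∫ x, (fderiv ℝ ψ x x) * (‖x‖^s * (‖x‖^2)⁻¹)
      = - ((N : ℝ) - 2 + s) * ∫ x, ψ x * (‖x‖^s * (‖x‖^2)⁻¹) := by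
  obtain ⟨R, hR⟩ := hc.isCompact.isBounded.subset_ball 0
  have hdc : Continuous (fderiv ℝ ψ) := hψ.continuous_fderiv (by norm_num)
  obtain ⟨M, hM⟩ := hdc.bounded_above_of_compact_support (hc.fderiv ℝ)
  have hM0 : 0 ≤ M := (norm_nonneg _).trans (hM 0)
  have hw : ∀ x : EuclideanSpace ℝ (Fin N), 0 ≤ ‖x‖^s * (‖x‖^2)⁻¹ := fun x => by positivity
  have hwm : Measurable (fun x : EuclideanSpace ℝ (Fin N) => ‖x‖^s * (‖x‖^2)⁻¹) := by
    fun_prop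
  have hbase : IntegrableOn (fun x : EuclideanSpace ℝ (Fin N) => ‖x‖ * (‖x‖^s * (‖x‖^2)⁻¹))
      (Metric.ball 0 (2*R)) := by
    obtain ⟨B, hB⟩ := (isCompact_closedBall (0 : EuclideanSpace ℝ (Fin N)) (2*R)).exists_bound_of_continuousOn
      (f := fun x => ‖x‖ * ‖x‖^s) (continuous_norm.mul (continuous_norm.rpow_const (fun x => Or.inr hs))).continuousOn
    have := (hd_base N hN (2*R)).bdd_mul (c := B) (f := fun x => ‖x‖ * ‖x‖^s)
      (continuous_norm.mul (continuous_norm.rpow_const (fun x => Or.inr hs))).aestronglyMeasurable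
      (by
        filter_upwards [ae_restrict_mem Metric.isOpen_ball.measurableSet] with x hx
        exact hB x (Metric.ball_subset_closedBall hx))
    change Integrable _ _
    simpa only [mul_assoc] using this
  rw [← integrable_indicator_iff Metric.isOpen_ball.measurableSet] at hbase
  have hder := (hasDerivAt_integral_of_dominated_loc_of_deriv_le (μ := volume) (𝕜 := ℝ)
    (F := fun (t : ℝ) (x : EuclideanSpace ℝ (Fin N)) => ψ (t • x) * (‖x‖^s * (‖x‖^2)⁻¹))
    (F' := fun (t : ℝ) (x : EuclideanSpace ℝ (Fin N)) =>
      (fderiv ℝ ψ (t • x) x) * (‖x‖^s * (‖x‖^2)⁻¹))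
    (x₀ := 1) (s := Ioo (1/2) 2)
    (bound := fun x => M * (Metric.ball 0 (2*R)).indicator (fun x => ‖x‖ * (‖x‖^s * (‖x‖^2)⁻¹)) x)
    (Ioo_mem_nhds (by norm_num) (by norm_num))
    (Filter.Eventually.of_forall fun t => 
      ((hψ.continuous.comp (continuous_const_smul t)).measurable.mul hwm).aestronglyMeasurable)
    (by simpa using hd_int N hN s hs ψ hψ.continuous hc)
    (by
      have : Continuous (fun x => fderiv ℝ ψ ((1:ℝ) • x) x) := 
        (hdc.comp (continuous_const_smul 1)).clm_apply continuous_id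
      exact (this.measurable.mul hwm).aestronglyMeasurable)
    (by
      refine Filter.Eventually.of_forall fun x t ht => ?_
      rw [norm_mul, Real.norm_of_nonneg (hw x)]
      by_cases hx : x ∈ Metric.ball (0 : EuclideanSpace ℝ (Fin N)) (2*R)
      · rw [indicator_of_mem hx, ← mul_assoc M]
        refine mul_le_mul_of_nonneg_right ?_ (hw x)
        exact ((fderiv ℝ ψ (t • x)).le_opNorm x).trans (by gcongr; exact hM _)
      · have : fderiv ℝ ψ (t • x) = 0 := by
          apply image_eq_zero_of_notMem_tsupport
          intro h
          have h := hR (tsupport_fderiv_subset ℝ h)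
          apply hx
          simp only [Metric.mem_ball, dist_zero_right, norm_smul, Real.norm_eq_abs] at h ⊢
          rw [abs_of_pos (by linarith [ht.1])] at h
          nlinarith [ht.1, norm_nonneg x]
        simp [this, indicator_of_notMem hx])
    (hbase.const_mul M)
    (by
      refine Filter.Eventually.of_forall fun x t ht => ?_
      apply HasDerivAt.mul_const
      have h1 : HasFDerivAt ψ (fderiv ℝ ψ (t • x)) (t • x) :=
        (hψ.differentiable (by norm_num) _).hasFDerivAt
      have h2 : HasDerivAt (fun t : ℝ => t • x) x t := by
        simpa using (hasDerivAt_id t).smul_const x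
      exact h1.comp_hasDerivAt t h2)).2
  have hscale : ∀ t : ℝ, 0 < t → ∫ x, ψ (t • x) * (‖x‖^s * (‖x‖^2)⁻¹)
      = t ^ (2 - s - N : ℝ) * ∫ x, ψ x * (‖x‖^s * (‖x‖^2)⁻¹) := by
    intro t ht
    have h := Measure.integral_comp_smul (volume : Measure (EuclideanSpace ℝ (Fin N)))
      (fun x => ψ x * (‖x‖^s * (‖x‖^2)⁻¹)) t
    have e : ∀ x : EuclideanSpace ℝ (Fin N), ψ (t • x) * (‖x‖^s * (‖x‖^2)⁻¹) =
        t ^ (2 - s) * (ψ (t • x) * (‖t • x‖^s * (‖t • x‖^2)⁻¹)) := by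
      intro x
      rw [norm_smul, Real.norm_of_nonneg ht.le, Real.mul_rpow ht.le (norm_nonneg _),
        Real.rpow_sub ht, mul_pow, mul_inv]
      have : t ^ s ≠ 0 := (Real.rpow_pos_of_pos ht s).ne'
      have h2 : t ^ (2:ℝ) = t ^ 2 := by norm_cast
      rw [h2]
      field_simp
    simp_rw [e]
    rw [integral_const_mul, h]
    rw [finrank_euclideanSpace, Fintype.card_fin, abs_of_pos (by positivity), smul_eq_mul,
      ← mul_assoc, Real.rpow_sub ht (2 - s), Real.rpow_natCast, div_eq_mul_inv]
  have hder2 : HasDerivAt (fun t : ℝ => t ^ (2 - s - N : ℝ) * ∫ x, ψ x * (‖x‖^s * (‖x‖^2)⁻¹))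
      ((2 - s - N) * ∫ x, ψ x * (‖x‖^s * (‖x‖^2)⁻¹)) 1 := by
    have := (Real.hasDerivAt_rpow_const (x := 1) (p := 2 - s - N) (Or.inl one_ne_zero)).mul_const 
      (∫ x, ψ x * (‖x‖^s * (‖x‖^2)⁻¹))
    simpa using this
  have hder3 := hder2.congr_of_eventuallyEq (f₁ := fun t => ∫ x, ψ (t • x) * (‖x‖^s * (‖x‖^2)⁻¹)) (by
    filter_upwards [Ioi_mem_nhds (zero_lt_one (α := ℝ))] with t ht
    exact hscale t ht)
  have := hder.unique hder3
  simp only [one_smul] at this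
  rw [this]; ring

theorem hd_real (f a P W S ρ M ε κ c : ℝ) (hW : 0 ≤ W) (hS : W * P^2 ≤ S) (hρ : 0 ≤ ρ)
    (hρM : ρ ≤ M) (hM : 0 < M) (hε : 0 < ε) (hκ : κ = ε / (4 * M)) (hc0 : 0 ≤ c)
    (hc1 : c * (4 * M) ≤ 1) (hc2 : c * (1 + 2 * a^2) ≤ κ * ε / 2) :
    c * (ρ * (f^2 * W + S)) ≤ S - a^2 * (f^2 * W) + a * (2 * f * P * W + 2 * a * (f^2 * W))
      + κ * (2 * f * P * (ρ * W) + (2 * a + ε) * (f^2 * (ρ * W))) := by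
  obtain ⟨Q, rfl⟩ : ∃ Q, P = Q - a * f := ⟨P + a * f, by ring⟩
  obtain ⟨G, rfl⟩ : ∃ G, S = G - 2 * a * f * W * Q + a^2 * f^2 * W :=
    ⟨S + 2 * a * f * W * Q - a^2 * f^2 * W, by ring⟩
  have hG : W * Q^2 ≤ G := by nlinarith
  have hκ0 : 0 ≤ κ := by rw [hκ]; positivity
  have hκε : κ * (4 * M) = ε := by rw [hκ]; field_simp
  have hG0 : 0 ≤ G := le_trans (by positivity) hG
  -- upper bound of the left side
  have h1 : G - 2 * a * f * W * Q + a^2 * f^2 * W ≤ 2 * G + 2 * a^2 * f^2 * W := by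
    nlinarith [mul_nonneg hW (sq_nonneg (Q + a * f))]
  have h2 : c * (ρ * (f^2 * W + (G - 2 * a * f * W * Q + a^2 * f^2 * W)))
      ≤ c * (ρ * (f^2 * W + (2 * G + 2 * a^2 * f^2 * W))) := by gcongr
  have h3 : c * ρ * (2 * G) ≤ G / 2 := by
    have : c * ρ ≤ c * M := by gcongr
    nlinarith
  have h4 : c * (1 + 2 * a^2) * (ρ * (f^2 * W)) ≤ κ * ε / 2 * (ρ * (f^2 * W)) :=
    mul_le_mul_of_nonneg_right hc2 (by positivity)
  -- the cross term
  have h5 : κ * ρ * W * (-(2 * f * Q)) ≤ κ * ρ * W * (ε / 2 * f^2 + 2 / ε * Q^2) := by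
    apply mul_le_mul_of_nonneg_left _ (by positivity)
    have : ε / 2 * f^2 + 2 / ε * Q^2 + 2 * f * Q = (ε * f + 2 * Q)^2 / (2 * ε) := by
      field_simp; ring
    have h : 0 ≤ (ε * f + 2 * Q)^2 / (2 * ε) := by positivity
    linarith
  have h6 : κ * ρ * (2 / ε) * (W * Q^2) ≤ 1 / 2 * G := by
    have : κ * ρ * (2 / ε) ≤ 1 / 2 := by
      have h : κ * ρ ≤ κ * M := by gcongr
      rw [mul_div_assoc', div_le_iff₀ hε]; linarith
    exact mul_le_mul this hG (by positivity) (by norm_num)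
  nlinarith

theorem hd_holder (N : ℕ) (hN : 3 ≤ N) (R q : ℝ) (hq1 : 1 ≤ q) (hq2 : q < 2)
    (h : EuclideanSpace ℝ (Fin N) → ℝ) (hh : Continuous h) (hc : HasCompactSupport h)
    (h0 : ∀ x, 0 ≤ h x) (hs : ∀ x, x ∉ Metric.ball (0 : EuclideanSpace ℝ (Fin N)) R → h x = 0) :
    ∫ x, h x ^ (q/2) ≤ (∫ x, ‖x‖ ^ ((2-q)/q) * h x) ^ (q/2) *
      (∫ x in Metric.ball (0 : EuclideanSpace ℝ (Fin N)) R, ‖x‖⁻¹) ^ ((2-q)/2) := by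
  have : Nontrivial (EuclideanSpace ℝ (Fin N)) := by
    have : Nonempty (Fin N) := ⟨⟨0, by omega⟩⟩
    infer_instance
  have hq0 : 0 < q := by linarith
  have hε : 0 < (2-q)/q := div_pos (by linarith) hq0
  rw [← setIntegral_eq_integral_of_forall_compl_eq_zero
      (s := Metric.ball (0 : EuclideanSpace ℝ (Fin N)) R) (f := fun x => h x ^ (q/2))
      (fun x hx => by rw [hs x hx, Real.zero_rpow (by positivity)]),
    ← setIntegral_eq_integral_of_forall_compl_eq_zero
      (s := Metric.ball (0 : EuclideanSpace ℝ (Fin N)) R) (f := fun x => ‖x‖ ^ ((2-q)/q) * h x)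
      (fun x hx => by rw [hs x hx, mul_zero])]
  have hpq : (2/q).HolderConjugate (2/(2-q)) := by
    rw [Real.holderConjugate_iff]
    refine ⟨by rw [lt_div_iff₀ hq0]; linarith, ?_⟩
    rw [inv_div, inv_div]; ring
  have hk : Continuous (fun x : EuclideanSpace ℝ (Fin N) => ‖x‖ ^ ((2-q)/q) * h x) :=
    (continuous_norm.rpow_const (fun x => Or.inr hε.le)).mul hh
  have hk0 : ∀ x, 0 ≤ ‖x‖ ^ ((2-q)/q) * h x := fun x => mul_nonneg (by positivity) (h0 x)
  have e1 : ∀ x, ((‖x‖ ^ ((2-q)/q) * h x) ^ (q/2)) ^ (2/q) = ‖x‖ ^ ((2-q)/q) * h x := by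
    intro x
    rw [← Real.rpow_mul (hk0 x), show q/2*(2/q) = 1 by field_simp, Real.rpow_one]
  have e2 : ∀ x : EuclideanSpace ℝ (Fin N), ((‖x‖⁻¹) ^ ((2-q)/2)) ^ (2/(2-q)) = ‖x‖⁻¹ := by
    intro x
    have : 2 - q ≠ 0 := by linarith
    rw [← Real.rpow_mul (by positivity), show (2-q)/2*(2/(2-q)) = 1 by field_simp, Real.rpow_one]
  have hD : IntegrableOn (fun x : EuclideanSpace ℝ (Fin N) => ‖x‖⁻¹) (Metric.ball 0 R) := by
    have := (hd_base N hN R).bdd_mul (c := R) (f := fun x => ‖x‖) continuous_norm.aestronglyMeasurable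
      (by
        filter_upwards [ae_restrict_mem Metric.isOpen_ball.measurableSet] with x hx
        rw [norm_norm]; exact (mem_ball_zero_iff.1 hx).le)
    refine Integrable.congr this (Filter.Eventually.of_forall fun x => ?_)
    by_cases hx : ‖x‖ = 0
    · simp [hx]
    · simp only; field_simp
  have H := integral_mul_le_Lp_mul_Lq_of_nonneg
    (μ := volume.restrict (Metric.ball (0 : EuclideanSpace ℝ (Fin N)) R)) hpq
    (f := fun x => (‖x‖ ^ ((2-q)/q) * h x) ^ (q/2)) (g := fun x => (‖x‖⁻¹) ^ ((2-q)/2))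
    (Filter.Eventually.of_forall fun x => Real.rpow_nonneg (hk0 x) _)
    (Filter.Eventually.of_forall fun x => by positivity)
    (by
      rw [← integrable_norm_rpow_iff (hk.rpow_const fun x => Or.inr (by positivity)).aestronglyMeasurable
        (by simpa using hpq.pos) ENNReal.ofReal_ne_top]
      rw [ENNReal.toReal_ofReal hpq.pos.le]
      simp_rw [Real.norm_of_nonneg (Real.rpow_nonneg (hk0 _) _), e1]
      exact (hk.integrable_of_hasCompactSupport hc.mul_left).integrableOn)
    (by
      rw [← integrable_norm_rpow_iff
        (show Measurable (fun x : EuclideanSpace ℝ (Fin N) => ‖x‖⁻¹ ^ ((2-q)/2)) from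
          measurable_norm.inv.pow_const _).aestronglyMeasurable
        (by simpa using hpq.symm.pos) ENNReal.ofReal_ne_top]
      rw [ENNReal.toReal_ofReal hpq.symm.pos.le]
      have : ∀ x : EuclideanSpace ℝ (Fin N), ‖(‖x‖⁻¹) ^ ((2-q)/2)‖ = (‖x‖⁻¹) ^ ((2-q)/2) :=
        fun x => Real.norm_of_nonneg (by positivity)
      simp_rw [this, e2]
      exact hD)
  simp_rw [e1, e2, one_div_div] at H
  refine le_trans (le_of_eq ?_) H
  apply integral_congr_ae
  have hne : ∀ᵐ x ∂(volume.restrict (Metric.ball (0 : EuclideanSpace ℝ (Fin N)) R)), x ≠ 0 :=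
    ae_restrict_of_ae (Measure.ae_ne volume 0)
  filter_upwards [hne] with x hx
  have hx : 0 < ‖x‖ := norm_pos_iff.2 hx
  rw [Real.mul_rpow (by positivity) (h0 x), ← Real.rpow_mul hx.le,
    show (2-q)/q*(q/2) = (2-q)/2 by field_simp, Real.inv_rpow hx.le]
  have : ‖x‖ ^ ((2-q)/2) ≠ 0 := (Real.rpow_pos_of_pos hx _).ne'
  field_simp
end

set_option maxHeartbeats 2000000

/-- **Improved Hardy–Poincaré inequality with `W^{1,q}`-norm.**
For `N ≥ 3`, a bounded open `Ω ⊆ ℝ^N` and `1 ≤ q < 2`, there is `C = C(q, Ω) > 0` such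
that for every test function `φ` on `Ω`,
`∫_Ω ‖∇φ‖² − μ* ∫_Ω φ²/‖x‖² ≥ C (∫_Ω (|φ|^q + ‖∇φ‖^q))^{2/q}`. -/
theorem improved_hardy_W1q (N : ℕ) (hN : 3 ≤ N)
    (Ω : Set (EuclideanSpace ℝ (Fin N))) (hΩo : IsOpen Ω) (hΩb : Bornology.IsBounded Ω)
    (q : ℝ) (hq1 : 1 ≤ q) (hq2 : q < 2) :
    ∃ C : ℝ, 0 < C ∧
      ∀ φ : EuclideanSpace ℝ (Fin N) → ℝ,
        ContDiff ℝ (⊤ : ℕ∞) φ → HasCompactSupport φ → tsupport φ ⊆ Ω →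
        C * (∫ x in Ω, (|φ x| ^ q + ‖gradient φ x‖ ^ q)) ^ (2 / q) ≤
          (∫ x in Ω, ‖gradient φ x‖ ^ 2) -
            (((N : ℝ) - 2) / 2) ^ 2 * ∫ x in Ω, (φ x) ^ 2 / ‖x‖ ^ 2 := by
  obtain ⟨R, hR1, hR⟩ : ∃ R : ℝ, 1 ≤ R ∧ Ω ⊆ Metric.ball 0 R := by
    obtain ⟨R, hR⟩ := hΩb.subset_ball 0
    exact ⟨max 1 R, le_max_left _ _, hR.trans (Metric.ball_subset_ball (le_max_right _ _))⟩
  have hq0 : 0 < q := by linarith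
  obtain ⟨ε, hεdef⟩ : ∃ ε : ℝ, ε = (2-q)/q := ⟨_, rfl⟩
  have hε : 0 < ε := by rw [hεdef]; exact div_pos (by linarith) hq0
  obtain ⟨a, ha⟩ : ∃ a : ℝ, a = ((N:ℝ)-2)/2 := ⟨_, rfl⟩
  obtain ⟨M, hMdef⟩ : ∃ M : ℝ, M = R ^ ε := ⟨_, rfl⟩
  have hM : 0 < M := by rw [hMdef]; positivity
  obtain ⟨κ, hκ⟩ : ∃ κ : ℝ, κ = ε / (4 * M) := ⟨_, rfl⟩
  have hκ0 : 0 < κ := by rw [hκ]; positivity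
  obtain ⟨c, hc0, hc1, hc2⟩ : ∃ c : ℝ, 0 < c ∧ c * (4 * M) ≤ 1 ∧ c * (1 + 2 * a^2) ≤ κ * ε / 2 := by
    refine ⟨min (1 / (4 * M)) (κ * ε / 2 / (1 + 2 * a^2)), by positivity, ?_, ?_⟩
    · rw [← le_div_iff₀ (by positivity)]; exact min_le_left _ _
    · rw [← le_div_iff₀ (by positivity)]; exact min_le_right _ _
  obtain ⟨D, hD⟩ : ∃ D : ℝ, D = ∫ x in Metric.ball (0 : EuclideanSpace ℝ (Fin N)) R, ‖x‖⁻¹ := ⟨_, rfl⟩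
  have hD0 : 0 ≤ D := by rw [hD]; exact integral_nonneg fun x => by positivity
  obtain ⟨L, hL⟩ : ∃ L : ℝ, L = (2 * D ^ ((2-q)/2)) ^ (2/q) + 1 := ⟨_, rfl⟩
  have hL0 : 0 < L := by rw [hL]; positivity
  refine ⟨c / (R^2 * L), by positivity, ?_⟩
  intro φ hφ hφc hφs
  have hφ1 : ContDiff ℝ 1 φ := hφ.of_le (by exact_mod_cast le_top)
  have hgrad : ∀ x y, fderiv ℝ φ x y = inner ℝ (gradient φ x) y := by
    intro x y
    simp [gradient]
  have hgc : Continuous (gradient φ) :=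
    (InnerProductSpace.toDual ℝ (EuclideanSpace ℝ (Fin N))).symm.continuous.comp
      (hφ1.continuous_fderiv (by norm_num))
  have hφz : ∀ x, x ∉ Ω → φ x = 0 := fun x hx =>
    image_eq_zero_of_notMem_tsupport fun h => hx (hφs h)
  have hgt : ∀ x, x ∉ tsupport φ → gradient φ x = 0 := by
    intro x hx
    have : fderiv ℝ φ x = 0 :=
      image_eq_zero_of_notMem_tsupport fun h => hx (tsupport_fderiv_subset ℝ h)
    simp [gradient, this]
  have hgz : ∀ x, x ∉ Ω → gradient φ x = 0 := fun x hx => hgt x fun h => hx (hφs h)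
  have hgs : HasCompactSupport (gradient φ) := HasCompactSupport.intro hφc hgt
  have hg2c : Continuous (fun x => ‖gradient φ x‖^2) := hgc.norm.pow 2
  have hg2s : HasCompactSupport (fun x => ‖gradient φ x‖^2) :=
    HasCompactSupport.intro hφc fun x hx => by simp [hgt x hx]
  have hψ : ContDiff ℝ 1 (fun x => φ x ^ 2) := hφ1.pow 2
  have hψs : HasCompactSupport (fun x => φ x ^ 2) :=
    HasCompactSupport.intro hφc fun x hx => by simp [image_eq_zero_of_notMem_tsupport hx]
  have hψd : ∀ x, fderiv ℝ (fun x => φ x ^ 2) x x = 2 * φ x * inner ℝ (gradient φ x) x := by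
    intro x
    have h1 := ((hφ1.differentiable (by norm_num) x).hasFDerivAt).pow 2
    rw [h1.fderiv, ← hgrad]
    simp
  have hcrossc : Continuous (fun x => 2 * φ x * inner ℝ (gradient φ x) x) :=
    (continuous_const.mul hφ1.continuous).mul (hgc.inner continuous_id)
  have hcrosss : HasCompactSupport (fun x => 2 * φ x * inner ℝ (gradient φ x) x) :=
    HasCompactSupport.intro hφc fun x hx => by simp [image_eq_zero_of_notMem_tsupport hx]
  -- the two identities
  have I0 := hd_ident N hN 0 le_rfl _ hψ hψs
  have I1 := hd_ident N hN ε hε.le _ hψ hψs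
  have A0 := hd_int N hN 0 le_rfl _ hψ.continuous hψs
  have A1 := hd_int N hN ε hε.le _ hψ.continuous hψs
  have B0 := hd_int N hN 0 le_rfl _ hcrossc hcrosss
  have B1 := hd_int N hN ε hε.le _ hcrossc hcrosss
  have S1 := hg2c.integrable_of_hasCompactSupport (μ := volume) hg2s
  simp_rw [hψd] at I0 I1
  simp only [Real.rpow_zero, one_mul] at I0 A0 B0
  have hNa : (N:ℝ) - 2 = 2 * a := by rw [ha]; ring
  rw [hNa] at I0 I1
  -- pointwise inequality, integrated
  have hcg : Continuous (fun x : EuclideanSpace ℝ (Fin N) => ‖x‖ ^ ε) :=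
    continuous_norm.rpow_const (fun x => Or.inr hε.le)
  have hhc : Continuous (fun x => φ x ^ 2 + ‖gradient φ x‖^2) := hψ.continuous.add hg2c
  have hhs : HasCompactSupport (fun x => φ x ^ 2 + ‖gradient φ x‖^2) := hψs.add hg2s
  have J1 : Integrable (fun x => ‖x‖ ^ ε * (φ x ^ 2 + ‖gradient φ x‖^2)) :=
    (hcg.mul hhc).integrable_of_hasCompactSupport hhs.mul_left
  have key : ∫ x, c / R^2 * (‖x‖ ^ ε * (φ x ^ 2 + ‖gradient φ x‖^2)) ≤
      ∫ x, (‖gradient φ x‖^2 - a^2 * (φ x ^ 2 * (‖x‖^2)⁻¹)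
        + a * (2 * φ x * inner ℝ (gradient φ x) x * (‖x‖^2)⁻¹ + 2 * a * (φ x ^ 2 * (‖x‖^2)⁻¹))
        + κ * (2 * φ x * inner ℝ (gradient φ x) x * (‖x‖ ^ ε * (‖x‖^2)⁻¹)
          + (2 * a + ε) * (φ x ^ 2 * (‖x‖ ^ ε * (‖x‖^2)⁻¹)))) := by
    refine integral_mono (J1.const_mul _)
      (((S1.sub (A0.const_mul _)).add ((B0.add (A0.const_mul _)).const_mul _)).add
        ((B1.add (A1.const_mul _)).const_mul _)) ?_
    intro x
    by_cases hx : x ∈ Ω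
    · have hxR : ‖x‖ < R := mem_ball_zero_iff.1 (hR hx)
      have hW : 0 ≤ (‖x‖^2)⁻¹ := by positivity
      have hCS : (‖x‖^2)⁻¹ * (inner ℝ (gradient φ x) x)^2 ≤ ‖gradient φ x‖^2 := by
        by_cases hx0 : x = 0
        · simp [hx0]
        · have : 0 < ‖x‖ := norm_pos_iff.2 hx0
          rw [inv_mul_le_iff₀ (by positivity), ← mul_pow, ← sq_abs]
          rw [mul_comm ‖x‖]
          have := abs_real_inner_le_norm (gradient φ x) x
          gcongr
      have hr := hd_real (φ x) a (inner ℝ (gradient φ x) x) (‖x‖^2)⁻¹ (‖gradient φ x‖^2) (‖x‖^ε) M ε κ c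
        hW hCS (by positivity) (by rw [hMdef]; gcongr) hM hε hκ hc0.le hc1 hc2
      refine le_trans ?_ hr
      by_cases hx0 : x = 0
      · simp [hx0, Real.zero_rpow hε.ne']
      · have hxp : 0 < ‖x‖ := norm_pos_iff.2 hx0
        change c / R^2 * (‖x‖ ^ ε * (φ x ^ 2 + ‖gradient φ x‖^2)) ≤ _
        rw [div_mul_eq_mul_div, mul_div_assoc]
        refine mul_le_mul_of_nonneg_left ?_ hc0.le
        rw [mul_div_assoc]
        refine mul_le_mul_of_nonneg_left ?_ (by positivity)
        rw [add_div]
        apply add_le_add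
        · rw [div_eq_mul_inv]; gcongr
        · exact div_le_self (by positivity) (by nlinarith)
    · simp [hφz x hx, hgz x hx]
  rw [integral_const_mul, integral_add, integral_add, integral_sub, integral_const_mul,
    integral_const_mul, integral_const_mul, integral_add, integral_add,
    integral_const_mul, integral_const_mul, I0, I1] at key
  rotate_left
  · exact B1
  · exact A1.const_mul _
  · exact B0
  · exact A0.const_mul _
  · exact S1
  · exact A0.const_mul _
  · exact S1.sub (A0.const_mul _)
  · exact (B0.add (A0.const_mul _)).const_mul _
  · exact (S1.sub (A0.const_mul _)).add ((B0.add (A0.const_mul _)).const_mul _)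
  · exact (B1.add (A1.const_mul _)).const_mul _
  obtain ⟨J, hJ⟩ : ∃ J : ℝ, J = ∫ x, ‖x‖ ^ ε * (φ x ^ 2 + ‖gradient φ x‖^2) := ⟨_, rfl⟩
  have hJ0 : 0 ≤ J := by rw [hJ]; exact integral_nonneg fun x => by positivity
  rw [← hJ] at key
  -- Hölder
  have hH := hd_holder N hN R q hq1 hq2 _ hhc hhs (fun x => by positivity)
    (fun x hx => by
      have : x ∉ Ω := fun h => hx (hR h)
      simp [hφz x this, hgz x this])
  rw [← hεdef, ← hJ, ← hD] at hH
  have e1 : ∫ x in Ω, ‖gradient φ x‖ ^ 2 = ∫ x, ‖gradient φ x‖ ^ 2 :=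
    setIntegral_eq_integral_of_forall_compl_eq_zero fun x hx => by simp [hgz x hx]
  have e2 : ∫ x in Ω, (φ x) ^ 2 / ‖x‖ ^ 2 = ∫ x, φ x ^ 2 * (‖x‖^2)⁻¹ :=
    setIntegral_eq_integral_of_forall_compl_eq_zero fun x hx => by simp [hφz x hx]
  have e3 : ∫ x in Ω, (|φ x| ^ q + ‖gradient φ x‖ ^ q) = ∫ x, (|φ x| ^ q + ‖gradient φ x‖ ^ q) :=
    setIntegral_eq_integral_of_forall_compl_eq_zero fun x hx => by
      simp [hφz x hx, hgz x hx, Real.zero_rpow hq0.ne']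
  rw [e1, e2, e3, ← ha]
  have hT : ∫ x, (|φ x| ^ q + ‖gradient φ x‖ ^ q) ≤
      2 * ∫ x, (φ x ^ 2 + ‖gradient φ x‖^2) ^ (q/2) := by
    rw [← integral_const_mul]
    have hi : Integrable (fun x => (φ x ^ 2 + ‖gradient φ x‖^2) ^ (q/2)) :=
      (hhc.rpow_const fun x => Or.inr (by positivity)).integrable_of_hasCompactSupport
        (hhs.comp_left (g := fun t : ℝ => t ^ (q/2)) (Real.zero_rpow (by positivity)))
    refine integral_mono_of_nonneg (Filter.Eventually.of_forall fun x => by positivity)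
      (hi.const_mul 2) (Filter.Eventually.of_forall fun x => ?_)
    have h2 : ∀ y : ℝ, 0 ≤ y → y ^ q = (y^2) ^ (q/2) := by
      intro y hy
      rw [← Real.rpow_natCast, ← Real.rpow_mul hy]; congr 1; push_cast; ring
    have h3 : |φ x| ^ q ≤ (φ x ^ 2 + ‖gradient φ x‖^2) ^ (q/2) := by
      rw [h2 _ (abs_nonneg _), sq_abs]
      exact Real.rpow_le_rpow (by positivity) (by nlinarith [sq_nonneg ‖gradient φ x‖]) (by positivity)
    have h4 : ‖gradient φ x‖ ^ q ≤ (φ x ^ 2 + ‖gradient φ x‖^2) ^ (q/2) := by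
      rw [h2 _ (norm_nonneg _)]
      exact Real.rpow_le_rpow (by positivity) (by nlinarith [sq_nonneg (φ x)]) (by positivity)
    simp only
    linarith
  have hT0 : 0 ≤ ∫ x, (|φ x| ^ q + ‖gradient φ x‖ ^ q) := integral_nonneg fun x => by positivity
  have hT2 : (∫ x, (|φ x| ^ q + ‖gradient φ x‖ ^ q)) ^ (2/q) ≤ L * J := by
    calc (∫ x, (|φ x| ^ q + ‖gradient φ x‖ ^ q)) ^ (2/q)
        ≤ (J ^ (q/2) * (2 * D ^ ((2-q)/2))) ^ (2/q) :=
          Real.rpow_le_rpow hT0 (by linarith) (by positivity)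
      _ = J * (2 * D ^ ((2-q)/2)) ^ (2/q) := by
          rw [Real.mul_rpow (by positivity) (by positivity), ← Real.rpow_mul hJ0,
            show q/2*(2/q) = 1 by field_simp, Real.rpow_one]
      _ ≤ L * J := by rw [hL]; linarith
  calc c / (R^2 * L) * (∫ x, (|φ x| ^ q + ‖gradient φ x‖ ^ q)) ^ (2/q)
      ≤ c / (R^2 * L) * (L * J) := mul_le_mul_of_nonneg_left hT2 (by positivity)
    _ = c / R^2 * J := by field_simp
    _ ≤ _ := by linarith
end

section
/- Let N ≥ 3, let Ω ⊆ ℝ^N be a bounded open set, let 0 < s < 1 and 1 ≤ r < 2N/(N − 2(1−s)). Then there exists a constant C = C(s, r, Ω) > 0 such that for every test function φ on Ω, ∫_Ω ‖∇φ(x)‖² dx − μ* ∫_Ω φ(x)²/‖x‖² dx ≥ C · ( ∫_Ω |φ(x)|^r dx + ∫_Ω ∫_Ω |φ(x) − φ(y)|^r / ‖x − y‖^{N + s r} dx dy )^{2/r} (improved Hardy–Poincaré inequality with fractional Sobolev W^{s,r}-norm, the fractional norm being given by the L^r norm plus the Gagliardo seminorm). -/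
open MeasureTheory

lemma aux_int_fderiv {N : ℕ} (u : EuclideanSpace ℝ (Fin N) → ℝ) (hu : ContDiff ℝ 1 u)
    (hc : HasCompactSupport u) (v : EuclideanSpace ℝ (Fin N)) :
    ∫ x, fderiv ℝ u x v = 0 := by
  have h1 : Integrable (fun x => fderiv ℝ u x v) := by
    apply Continuous.integrable_of_hasCompactSupport
    · exact (hu.continuous_fderiv (by simp)).clm_apply continuous_const
    · exact hc.fderiv_apply (𝕜 := ℝ) v
  have := integral_mul_fderiv_eq_neg_fderiv_mul_of_integrable (μ := volume)
    (f := fun _ : EuclideanSpace ℝ (Fin N) => (1:ℝ)) (g := u) (v := v)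
    (by simp) (by simpa using h1)
    (by simpa using hu.continuous.integrable_of_hasCompactSupport hc)
    (by intro x _; fun_prop) (by intro x _; exact (hu.differentiable (by simp)).differentiableAt)
  simpa using this

lemma aux_div {N : ℕ} (u : EuclideanSpace ℝ (Fin N) → ℝ) (hu : ContDiff ℝ 1 u)
    (hc : HasCompactSupport u) :
    ∫ x, ((N : ℝ) * u x + fderiv ℝ u x x) = 0 := by
  have key : ∀ x, (N : ℝ) * u x + fderiv ℝ u x x
      = ∑ i : Fin N, fderiv ℝ (fun y => u y * y i) x (EuclideanSpace.single i 1) := by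
    intro x
    have hd : ∀ i : Fin N, fderiv ℝ (fun y : EuclideanSpace ℝ (Fin N) => u y * y i) x
        (EuclideanSpace.single i 1) = u x + x i * fderiv ℝ u x (EuclideanSpace.single i 1) := by
      intro i
      have h1 : HasFDerivAt u (fderiv ℝ u x) x :=
        (hu.differentiable (by simp)).differentiableAt.hasFDerivAt
      have h2 : HasFDerivAt (fun y : EuclideanSpace ℝ (Fin N) => y i)
          (EuclideanSpace.proj i : EuclideanSpace ℝ (Fin N) →L[ℝ] ℝ) x :=
        (EuclideanSpace.proj i : EuclideanSpace ℝ (Fin N) →L[ℝ] ℝ).hasFDerivAt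
      have h3 := h1.fun_mul h2
      rw [h3.fderiv]
      simp
    simp_rw [hd]
    rw [Finset.sum_add_distrib]
    simp only [Finset.sum_const, Finset.card_univ, Fintype.card_fin, nsmul_eq_mul]
    congr 1
    have hx : x = ∑ i : Fin N, x i • EuclideanSpace.single i (1:ℝ) := by
      ext j
      simp [Pi.single_apply]
    have h4 := congrArg (fderiv ℝ u x) hx
    rw [h4, map_sum]
    simp only [map_smul, smul_eq_mul]
  simp_rw [key]
  have hs : ∀ i : Fin N, ContDiff ℝ 1 (fun y : EuclideanSpace ℝ (Fin N) => u y * y i) := by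
    intro i
    exact hu.mul (EuclideanSpace.proj i : EuclideanSpace ℝ (Fin N) →L[ℝ] ℝ).contDiff
  have hcs : ∀ i : Fin N, HasCompactSupport (fun y : EuclideanSpace ℝ (Fin N) => u y * y i) := by
    intro i
    exact hc.mul_right
  rw [integral_finsetSum]
  · exact Finset.sum_eq_zero fun i _ => aux_int_fderiv _ (hs i) (hcs i) _
  · intro i _
    apply Continuous.integrable_of_hasCompactSupport
    · exact ((hs i).continuous_fderiv (by simp)).clm_apply continuous_const
    · exact (hcs i).fderiv_apply (𝕜 := ℝ) _

/-- pointwise algebraic inequality -/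
lemma aux_alg (n a β κ w t ρ A m p : ℝ) (ha : 0 < a) (hn : n = 2 * a + 2) (hβ : 0 < β) (hβ1 : β ≤ 1)
    (hκ : κ * β = a ^ 2) (hw : 0 ≤ w) (hw1 : w * (κ ^ 2 + 2 * a * κ + 2 * a ^ 2) ≤ a ^ 2)
    (ht : 0 ≤ t) (hρ : 0 < ρ) (htρ : t ≤ ρ) (hm : m ^ 2 ≤ A ^ 2 * t) (hA : 0 ≤ A) :
    w * A ^ 2 ≤ A ^ 2 - a ^ 2 * (p ^ 2 / ρ) + (n * (p ^ 2 * ((a + κ * w) / ρ)) +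
      (2 * p * m * ((a + κ * w) / ρ) +
        p ^ 2 * (2 * t * ((κ * β * w - (a + κ * w)) / ρ ^ 2)))) := by
  have hκ0 : 0 < κ := by
    by_contra h
    push Not at h
    nlinarith [pow_pos ha 2]
  have hw2 : w ≤ 1 / 2 := by
    have : 0 < a ^ 2 := by positivity
    have : 0 ≤ w * (κ ^ 2 + 2 * a * κ) := by positivity
    nlinarith
  set f := a + κ * w with hf
  have hfpos : 0 < f := by positivity
  set g := f / ρ with hg
  have hgpos : 0 < g := by positivity
  set B := n * g + 2 * t * ((κ * β * w - f) / ρ ^ 2) - a ^ 2 / ρ with hB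
  have hBb : (a ^ 2 + 2 * a * κ * w + 2 * κ * β * w) / ρ ≤ B := by
    have : B - (a ^ 2 + 2 * a * κ * w + 2 * κ * β * w) / ρ
        = 2 * (f - κ * β * w) * (ρ - t) / ρ ^ 2 := by
      rw [hB, hg, hn]
      field_simp
      rw [hf]; ring
    have h2 : 0 ≤ f - κ * β * w := by
      have : κ * β * w ≤ κ * 1 * w := by gcongr
      rw [hf]; linarith
    have h3 : 0 ≤ 2 * (f - κ * β * w) * (ρ - t) / ρ ^ 2 := by
      have : 0 ≤ ρ - t := by linarith
      positivity
    linarith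
  have hgB : g ^ 2 * t ≤ (1 - w) * B := by
    have h1 : g ^ 2 * t ≤ f ^ 2 / ρ := by
      rw [hg, div_pow, div_mul_eq_mul_div, div_le_div_iff₀ (by positivity) hρ]
      have : 0 ≤ f ^ 2 * ρ := by positivity
      nlinarith
    have h2 : f ^ 2 ≤ (1 - w) * (a ^ 2 + 2 * a * κ * w + 2 * κ * β * w) := by
      have : (1 - w) * (a ^ 2 + 2 * a * κ * w + 2 * κ * β * w) - f ^ 2
        = w * (a ^ 2 - w * (κ ^ 2 + 2 * a * κ + 2 * a ^ 2)) := by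
        rw [hf]
        linear_combination (2 * w - 2 * w ^ 2) * hκ
      nlinarith [mul_nonneg hw (sub_nonneg.2 hw1)]
    calc g ^ 2 * t ≤ f ^ 2 / ρ := h1
      _ ≤ ((1 - w) * (a ^ 2 + 2 * a * κ * w + 2 * κ * β * w)) / ρ := by gcongr
      _ = (1 - w) * ((a ^ 2 + 2 * a * κ * w + 2 * κ * β * w) / ρ) := by ring
      _ ≤ (1 - w) * B := by
        have : 0 ≤ 1 - w := by linarith
        gcongr
  have h1w : 0 < 1 - w := by linarith
  have main : 0 ≤ (1 - w) * ((1 - w) * A ^ 2 + 2 * p * m * g + p ^ 2 * B) := by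
    have e1 : |p * m * g| ≤ |p| * g * (A * √t) := by
      have : |m| ≤ A * √t := by
        apply abs_le_of_sq_le_sq _ (by positivity)
        rw [mul_pow, Real.sq_sqrt ht]; exact hm
      rw [abs_mul, abs_mul, abs_of_pos hgpos]
      calc |p| * |m| * g ≤ |p| * (A * √t) * g := by gcongr
        _ = _ := by ring
    have e2 := neg_le_of_abs_le e1
    have e3 := mul_le_mul_of_nonneg_left hgB (sq_nonneg p)
    have e4 := sq_nonneg ((1 - w) * A - |p| * g * √t)
    have e5 : (|p| * g * √t) ^ 2 = p ^ 2 * (g ^ 2 * t) := by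
      rw [mul_pow, mul_pow, Real.sq_sqrt ht, sq_abs]; ring
    have e6 := mul_le_mul_of_nonneg_left e2 h1w.le
    nlinarith
  have := nonneg_of_mul_nonneg_right main h1w
  have e : A ^ 2 - a ^ 2 * (p ^ 2 / ρ) + (n * (p ^ 2 * g) +
      (2 * p * m * g + p ^ 2 * (2 * t * ((κ * β * w - f) / ρ ^ 2)))) - w * A ^ 2
      = (1 - w) * A ^ 2 + 2 * p * m * g + p ^ 2 * B := by
    rw [hB]; ring
  linarith

lemma aux_A1 {N : ℕ} (a β R : ℝ) (ha : 0 < a) (hn : (N : ℝ) = 2 * a + 2) (hβ : 0 < β) (hβ1 : β ≤ 1) :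
    ∃ c : ℝ, 0 < c ∧ ∀ φ : EuclideanSpace ℝ (Fin N) → ℝ, ContDiff ℝ 1 φ → HasCompactSupport φ →
      (∀ x ∈ tsupport φ, ‖x‖ ≤ R) → ∀ δ : ℝ, 0 < δ → δ ≤ 1 →
      c * ∫ x, ‖x‖ ^ (2 * β) * ‖fderiv ℝ φ x‖ ^ 2 ≤
        (∫ x, ‖fderiv ℝ φ x‖ ^ 2) - a ^ 2 * ∫ x, φ x ^ 2 / (‖x‖ ^ 2 + δ) := by
  set κ : ℝ := a ^ 2 / β with hκ
  have hκβ : κ * β = a ^ 2 := by rw [hκ]; field_simp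
  have hκ0 : 0 < κ := by positivity
  set w0 : ℝ := a ^ 2 / (κ ^ 2 + 2 * a * κ + 2 * a ^ 2) with hw0
  have hw0p : 0 < w0 := by positivity
  set c : ℝ := w0 / (R ^ 2 + 1) ^ β with hc
  have hcp : 0 < c := by positivity
  refine ⟨c, hcp, ?_⟩
  intro φ hφ hφc hφR δ hδ hδ1
  have hρ : ∀ x : EuclideanSpace ℝ (Fin N), 0 < ‖x‖ ^ 2 + δ := fun x => by positivity
  set g : EuclideanSpace ℝ (Fin N) → ℝ :=
    fun x => (a + κ * (c * (‖x‖ ^ 2 + δ) ^ β)) / (‖x‖ ^ 2 + δ) with hg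
  have hρs : ContDiff ℝ 1 (fun x : EuclideanSpace ℝ (Fin N) => ‖x‖ ^ 2 + δ) :=
    (contDiff_norm_sq ℝ).add contDiff_const
  have hgs : ContDiff ℝ 1 g := by
    apply ContDiff.div
    · exact contDiff_const.add (contDiff_const.mul (contDiff_const.mul
        (hρs.rpow_const_of_ne (fun x => (hρ x).ne'))))
    · exact hρs
    · exact fun x => (hρ x).ne'
  have hus : ContDiff ℝ 1 (fun x => φ x ^ 2 * g x) := (hφ.pow 2).mul hgs
  have hφ2c : HasCompactSupport (fun x => φ x ^ 2) := by
    have : (fun x => φ x ^ 2) = fun x => φ x * φ x := by ext x; ring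
    rw [this]; exact hφc.mul_right
  have huc : HasCompactSupport (fun x => φ x ^ 2 * g x) := hφ2c.mul_right
  have hdiv := aux_div _ hus huc
  have hfd : ∀ x, fderiv ℝ (fun x => φ x ^ 2 * g x) x x =
      2 * φ x * (fderiv ℝ φ x x) * g x + φ x ^ 2 * (2 * ‖x‖ ^ 2 *
        ((κ * β * (c * (‖x‖ ^ 2 + δ) ^ β) - (a + κ * (c * (‖x‖ ^ 2 + δ) ^ β)))
          / (‖x‖ ^ 2 + δ) ^ 2)) := by
    intro x
    have h1 : HasFDerivAt φ (fderiv ℝ φ x) x :=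
      (hφ.differentiable (by simp)).differentiableAt.hasFDerivAt
    have h2 : HasFDerivAt (fun y : EuclideanSpace ℝ (Fin N) => ‖y‖ ^ 2) (2 • (innerSL ℝ x)) x :=
      (hasStrictFDerivAt_norm_sq x).hasFDerivAt
    have h3 : HasDerivAt (fun t : ℝ => (a + κ * (c * (t + δ) ^ β)) / (t + δ))
        ((κ * β * (c * (‖x‖ ^ 2 + δ) ^ β) - (a + κ * (c * (‖x‖ ^ 2 + δ) ^ β)))
          / (‖x‖ ^ 2 + δ) ^ 2) (‖x‖ ^ 2) := by
      have e0 : HasDerivAt (fun t : ℝ => t + δ) 1 (‖x‖ ^ 2) := (hasDerivAt_id _).add_const δ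
      have e1 := (((e0.rpow_const (p := β) (Or.inl (hρ x).ne')).const_mul c).const_mul κ).const_add a
      have e2 := e1.fun_div e0 (hρ x).ne'
      refine e2.congr_deriv ?_
      rw [Real.rpow_sub_one (hρ x).ne']
      have := (hρ x).ne'
      field_simp
    have h4' := h3.comp_hasFDerivAt x h2
    have h4 : HasFDerivAt g _ x := h4'
    have h5 := (h1.pow 2).fun_mul h4
    rw [h5.fderiv]
    simp only [add_apply, smul_apply, smul_eq_mul,
      innerSL_apply_apply, nsmul_eq_mul]
    rw [real_inner_self_eq_norm_sq]
    simp
    ring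
  have hDc : Continuous (fderiv ℝ φ) := hφ.continuous_fderiv (by simp)
  have hDcs : HasCompactSupport (fderiv ℝ φ) := hφc.fderiv ℝ
  have hD2cs : HasCompactSupport (fun x => ‖fderiv ℝ φ x‖ ^ 2) :=
    hDcs.comp_left (g := fun y => ‖y‖ ^ 2) (by simp)
  have i1 : Integrable (fun x => ‖fderiv ℝ φ x‖ ^ 2) :=
    (hDc.norm.pow 2).integrable_of_hasCompactSupport hD2cs
  have i2 : Integrable (fun x => φ x ^ 2 / (‖x‖ ^ 2 + δ)) := by
    simp_rw [div_eq_mul_inv]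
    apply Continuous.integrable_of_hasCompactSupport
    · exact (hφ.continuous.pow 2).mul (hρs.continuous.inv₀ fun x => (hρ x).ne')
    · exact hφ2c.mul_right
  have i3 : Integrable (fun x => (N : ℝ) * (φ x ^ 2 * g x) +
      fderiv ℝ (fun x => φ x ^ 2 * g x) x x) := by
    apply Integrable.add
    · exact (hus.continuous.integrable_of_hasCompactSupport huc).const_mul _
    · apply Continuous.integrable_of_hasCompactSupport
      · exact (hus.continuous_fderiv (by simp)).clm_apply continuous_id
      · apply (huc.fderiv ℝ).mono
        intro x hx
        simp only [Function.mem_support] at hx ⊢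
        contrapose! hx
        simp [hx]
  have i4 : Integrable (fun x => ‖x‖ ^ (2 * β) * ‖fderiv ℝ φ x‖ ^ 2) := by
    apply Continuous.integrable_of_hasCompactSupport
    · exact (continuous_norm.rpow_const (fun x => Or.inr (by positivity))).mul (hDc.norm.pow 2)
    · exact hD2cs.mul_left
  have i5 : Integrable (fun x => ‖fderiv ℝ φ x‖ ^ 2 - a ^ 2 * (φ x ^ 2 / (‖x‖ ^ 2 + δ))) :=
    i1.sub (i2.const_mul _)
  rw [← integral_const_mul, ← integral_const_mul, ← integral_sub i1 (i2.const_mul _),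
    ← add_zero (∫ x, _ - _), ← hdiv, ← integral_add i5 i3]
  apply integral_mono (i4.const_mul c) (i5.add i3)
  intro x
  by_cases hx : x ∈ tsupport φ
  · have hxR := hφR x hx
    have hle : c * (‖x‖ ^ 2 + δ) ^ β ≤ w0 := by
      rw [hc, div_mul_eq_mul_div, div_le_iff₀ (by positivity)]
      have : (‖x‖ ^ 2 + δ) ^ β ≤ (R ^ 2 + 1) ^ β := by gcongr
      gcongr
    have halg := aux_alg N a β κ (c * (‖x‖ ^ 2 + δ) ^ β) (‖x‖ ^ 2) (‖x‖ ^ 2 + δ) ‖fderiv ℝ φ x‖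
      (fderiv ℝ φ x x) (φ x) ha hn hβ hβ1 hκβ (by positivity)
      (by
        calc _ ≤ w0 * (κ ^ 2 + 2 * a * κ + 2 * a ^ 2) := by gcongr
          _ = a ^ 2 := by rw [hw0]; field_simp)
      (by positivity) (hρ x) (by linarith)
      (by
        have := (fderiv ℝ φ x).le_opNorm x
        rw [← mul_pow, ← sq_abs]
        exact pow_le_pow_left₀ (abs_nonneg _) this 2)
      (norm_nonneg _)
    have hpow : ‖x‖ ^ (2 * β) ≤ (‖x‖ ^ 2 + δ) ^ β := by
      rw [Real.rpow_mul (norm_nonneg _), Real.rpow_two]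
      gcongr
      linarith
    simp only [hfd]
    calc c * (‖x‖ ^ (2 * β) * ‖fderiv ℝ φ x‖ ^ 2)
        ≤ c * ((‖x‖ ^ 2 + δ) ^ β * ‖fderiv ℝ φ x‖ ^ 2) := by gcongr
      _ = c * (‖x‖ ^ 2 + δ) ^ β * ‖fderiv ℝ φ x‖ ^ 2 := by ring
      _ ≤ _ := halg
  · have h0 : φ x = 0 := image_eq_zero_of_notMem_tsupport hx
    have h1 : fderiv ℝ φ x = 0 := by
      by_contra h
      exact hx (support_fderiv_subset ℝ h)
    simp [hfd, h0, h1]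

lemma aux_A2 {N : ℕ} (a β R : ℝ) (ha : 0 < a) (hn : (N : ℝ) = 2 * a + 2) (hβ : 0 < β) (hβ1 : β ≤ 1) :
    ∃ c : ℝ, 0 < c ∧ ∀ φ : EuclideanSpace ℝ (Fin N) → ℝ, ContDiff ℝ 1 φ → HasCompactSupport φ →
      (∀ x ∈ tsupport φ, ‖x‖ ≤ R) →
      c * ∫ x, ‖x‖ ^ (2 * β) * ‖fderiv ℝ φ x‖ ^ 2 ≤
        (∫ x, ‖fderiv ℝ φ x‖ ^ 2) - a ^ 2 * ∫ x, φ x ^ 2 / ‖x‖ ^ 2 := by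
  obtain ⟨c, hc, H⟩ := aux_A1 (N := N) a β R ha hn hβ hβ1
  refine ⟨c, hc, ?_⟩
  intro φ hφ hφc hφR
  by_cases hi : Integrable (fun x => φ x ^ 2 / ‖x‖ ^ 2)
  · have hN : Nontrivial (EuclideanSpace ℝ (Fin N)) := by
      apply Module.nontrivial_of_finrank_pos (R := ℝ)
      rw [finrank_euclideanSpace_fin]
      have : (0:ℝ) < N := by linarith
      exact_mod_cast this
    have hlim : Filter.Tendsto (fun n : ℕ => ∫ x, φ x ^ 2 / (‖x‖ ^ 2 + 1 / ((n : ℝ) + 1)))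
        Filter.atTop (nhds (∫ x, φ x ^ 2 / ‖x‖ ^ 2)) := by
      apply tendsto_integral_of_dominated_convergence _ _ hi
      · intro n
        filter_upwards [compl_mem_ae_iff.2 (measure_singleton (0 : EuclideanSpace ℝ (Fin N)))]
          with x hx
        have hx0 : 0 < ‖x‖ := norm_pos_iff.2 hx
        have hn0 : 0 < 1 / ((n : ℝ) + 1) := by positivity
        rw [Real.norm_of_nonneg (by positivity)]
        gcongr
        linarith
      · filter_upwards [compl_mem_ae_iff.2 (measure_singleton (0 : EuclideanSpace ℝ (Fin N)))]
          with x hx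
        have hx0 : 0 < ‖x‖ := norm_pos_iff.2 hx
        have := (tendsto_one_div_add_atTop_nhds_zero_nat (𝕜 := ℝ)).const_add (‖x‖ ^ 2)
        rw [add_zero] at this
        exact tendsto_const_nhds.div this (by positivity)
      · intro n
        apply Continuous.aestronglyMeasurable
        apply (hφ.continuous.pow 2).div
        · fun_prop
        · intro x; positivity
    have hlim2 := (hlim.const_mul (a ^ 2)).const_sub (∫ x, ‖fderiv ℝ φ x‖ ^ 2)
    apply ge_of_tendsto' hlim2
    intro n
    apply H φ hφ hφc hφR _ (by positivity)
    rw [div_le_one (by positivity)]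
    have : (0:ℝ) ≤ n := by positivity
    linarith
  · rw [integral_undef hi]
    have h1 := H φ hφ hφc hφR 1 one_pos le_rfl
    have h2 : 0 ≤ ∫ x, φ x ^ 2 / (‖x‖ ^ 2 + 1) := by
      apply integral_nonneg; intro x; positivity
    have : 0 ≤ a ^ 2 * ∫ x, φ x ^ 2 / (‖x‖ ^ 2 + 1) := by positivity
    linarith

lemma aux_ball_fin {N : ℕ} (hN : 3 ≤ N) (α : ℝ) (hα : α < N) (R : ℝ) :
    ∫⁻ x in Metric.closedBall (0 : EuclideanSpace ℝ (Fin N)) R, ENNReal.ofReal (‖x‖ ^ (-α)) < ⊤ := by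
  have h : LocallyIntegrable (fun x : EuclideanSpace ℝ (Fin N) => ‖x‖ ^ (-α)) := by
    refine locallyIntegrable_of_norm_le_rpow (C := 1) (α := α) ?_ ?_ ?_ ?_
    · rw [finrank_euclideanSpace_fin]; omega
    · rw [finrank_euclideanSpace_fin]; exact hα
    · filter_upwards with x
      rw [Real.norm_of_nonneg (by positivity), one_mul]
    · exact (measurable_norm.pow_const _).aestronglyMeasurable
  have h2 := h.integrableOn_isCompact (isCompact_closedBall 0 R)
  exact h2.lintegral_lt_top

lemma aux_A3 {N : ℕ} (hN : 3 ≤ N) (q R : ℝ) (hq : 1 ≤ q) (hq2 : q < 2) :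
    ∃ K : ENNReal, K ≠ ⊤ ∧ ∀ φ : EuclideanSpace ℝ (Fin N) → ℝ, ContDiff ℝ 1 φ →
      HasCompactSupport φ → (∀ x ∈ tsupport φ, ‖x‖ ≤ R) →
      0 ≤ (∫ x, ‖fderiv ℝ φ x‖ ^ 2) - (((N : ℝ) - 2) / 2) ^ 2 * ∫ x, φ x ^ 2 / ‖x‖ ^ 2 ∧
      ∫⁻ x, ‖fderiv ℝ φ x‖ₑ ^ q ≤ K * ENNReal.ofReal
        ((∫ x, ‖fderiv ℝ φ x‖ ^ 2) - (((N : ℝ) - 2) / 2) ^ 2 * ∫ x, φ x ^ 2 / ‖x‖ ^ 2) ^ (q / 2) := by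
  have hN' : (3 : ℝ) ≤ N := by exact_mod_cast hN
  obtain ⟨c, hc, H⟩ := aux_A2 (N := N) (((N : ℝ) - 2) / 2) (1 - q / 2) R (by linarith) (by ring)
    (by linarith) (by linarith)
  set K0 := ∫⁻ x in Metric.closedBall (0 : EuclideanSpace ℝ (Fin N)) R,
    ENNReal.ofReal (‖x‖ ^ (-q)) with hK0
  have hK0t : K0 < ⊤ := aux_ball_fin hN q (by linarith) R
  refine ⟨ENNReal.ofReal (1 / c) ^ (q / 2) * K0 ^ (1 - q / 2), ?_, ?_⟩
  · apply ENNReal.mul_ne_top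
    · exact ENNReal.rpow_ne_top_of_nonneg (by linarith) ENNReal.ofReal_ne_top
    · exact ENNReal.rpow_ne_top_of_nonneg (by linarith) hK0t.ne
  intro φ hφ hφc hφR
  have h1 := H φ hφ hφc hφR
  set Hφ := (∫ x, ‖fderiv ℝ φ x‖ ^ 2) - (((N : ℝ) - 2) / 2) ^ 2 * ∫ x, φ x ^ 2 / ‖x‖ ^ 2 with hH
  have hJ0 : 0 ≤ ∫ x, ‖x‖ ^ (2 * (1 - q / 2)) * ‖fderiv ℝ φ x‖ ^ 2 := by
    apply integral_nonneg; intro x; positivity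
  have hH0 : 0 ≤ Hφ := le_trans (by positivity) h1
  refine ⟨hH0, ?_⟩
  have hDc : Continuous (fderiv ℝ φ) := hφ.continuous_fderiv (by simp)
  have hwc : Continuous (fun x : EuclideanSpace ℝ (Fin N) =>
      ‖x‖ ^ (2 * (1 - q / 2)) * ‖fderiv ℝ φ x‖ ^ 2) :=
    (continuous_norm.rpow_const (fun x => Or.inr (by linarith))).mul (hDc.norm.pow 2)
  have i4 : Integrable (fun x : EuclideanSpace ℝ (Fin N) =>
      ‖x‖ ^ (2 * (1 - q / 2)) * ‖fderiv ℝ φ x‖ ^ 2) := by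
    apply hwc.integrable_of_hasCompactSupport
    have : HasCompactSupport (fun x => ‖fderiv ℝ φ x‖ ^ 2) :=
      (hφc.fderiv ℝ).comp_left (g := fun y => ‖y‖ ^ 2) (by simp)
    exact this.mul_left
  have hnt : Nontrivial (EuclideanSpace ℝ (Fin N)) := by
    apply Module.nontrivial_of_finrank_pos (R := ℝ)
    rw [finrank_euclideanSpace_fin]
    omega
  have s1 : ∫⁻ x, ‖fderiv ℝ φ x‖ₑ ^ q =
      ∫⁻ x in Metric.closedBall (0 : EuclideanSpace ℝ (Fin N)) R, ‖fderiv ℝ φ x‖ₑ ^ q := by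
    rw [setLIntegral_eq_of_support_subset]
    intro x hx
    simp only [Function.mem_support] at hx
    have : x ∈ tsupport φ := by
      apply support_fderiv_subset ℝ
      intro h
      apply hx
      rw [← ofReal_norm, h, norm_zero, ENNReal.ofReal_zero, ENNReal.zero_rpow_of_pos (by linarith)]
    simpa using hφR x this
  have s2 : ∫⁻ x in Metric.closedBall (0 : EuclideanSpace ℝ (Fin N)) R, ‖fderiv ℝ φ x‖ₑ ^ q ≤
      ∫⁻ x in Metric.closedBall (0 : EuclideanSpace ℝ (Fin N)) R,
        ENNReal.ofReal (‖x‖ ^ (2 * (1 - q / 2)) * ‖fderiv ℝ φ x‖ ^ 2) ^ (q / 2) *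
          ENNReal.ofReal (‖x‖ ^ (-q)) ^ (1 - q / 2) := by
    apply lintegral_mono_ae
    apply ae_restrict_of_ae
    filter_upwards [compl_mem_ae_iff.2 (measure_singleton (0 : EuclideanSpace ℝ (Fin N)))] with x hx
    have hx0 : 0 < ‖x‖ := norm_pos_iff.2 hx
    rw [ENNReal.ofReal_rpow_of_nonneg (by positivity) (by linarith),
      ENNReal.ofReal_rpow_of_nonneg (by positivity) (by linarith),
      ← ENNReal.ofReal_mul (by positivity), ← ofReal_norm,
      ENNReal.ofReal_rpow_of_nonneg (by positivity) (by linarith)]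
    apply ENNReal.ofReal_le_ofReal
    apply le_of_eq
    rw [Real.mul_rpow (by positivity) (by positivity), ← Real.rpow_mul hx0.le,
      ← Real.rpow_mul hx0.le, ← Real.rpow_natCast, ← Real.rpow_mul (norm_nonneg _)]
    rw [mul_right_comm, ← Real.rpow_add hx0]
    have e1 : 2 * (1 - q / 2) * (q / 2) + -q * (1 - q / 2) = 0 := by ring
    have e2 : ((2:ℕ) : ℝ) * (q / 2) = q := by push_cast; ring
    rw [e1, e2]
    simp
  have s3 := ENNReal.lintegral_mul_norm_pow_le
    (μ := volume.restrict (Metric.closedBall (0 : EuclideanSpace ℝ (Fin N)) R))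
    (f := fun x => ENNReal.ofReal (‖x‖ ^ (2 * (1 - q / 2)) * ‖fderiv ℝ φ x‖ ^ 2))
    (g := fun x => ENNReal.ofReal (‖x‖ ^ (-q))) (p := q / 2) (q := 1 - q / 2)
    (hwc.measurable.ennreal_ofReal.aemeasurable)
    ((measurable_norm.pow_const _).ennreal_ofReal.aemeasurable)
    (by linarith) (by linarith) (by ring)
  have s4 : ∫⁻ x in Metric.closedBall (0 : EuclideanSpace ℝ (Fin N)) R,
      ENNReal.ofReal (‖x‖ ^ (2 * (1 - q / 2)) * ‖fderiv ℝ φ x‖ ^ 2) ≤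
      ENNReal.ofReal (1 / c) * ENNReal.ofReal Hφ := by
    calc _ ≤ ∫⁻ x, ENNReal.ofReal (‖x‖ ^ (2 * (1 - q / 2)) * ‖fderiv ℝ φ x‖ ^ 2) :=
          setLIntegral_le_lintegral _ _
      _ = ENNReal.ofReal (∫ x, ‖x‖ ^ (2 * (1 - q / 2)) * ‖fderiv ℝ φ x‖ ^ 2) := by
        rw [ofReal_integral_eq_lintegral_ofReal i4]
        filter_upwards with x
        positivity
      _ ≤ _ := by
        rw [← ENNReal.ofReal_mul (by positivity)]
        apply ENNReal.ofReal_le_ofReal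
        rw [one_div, inv_mul_eq_div, le_div_iff₀ hc, mul_comm]
        exact h1
  rw [s1]
  refine (s2.trans s3).trans ?_
  calc _ ≤ (ENNReal.ofReal (1 / c) * ENNReal.ofReal Hφ) ^ (q / 2) * K0 ^ (1 - q / 2) := by
        have : 0 ≤ q / 2 := by linarith
        gcongr
    _ = _ := by
        rw [ENNReal.mul_rpow_of_nonneg _ _ (by linarith)]
        ring

lemma aux_B {N : ℕ} (q : ℝ) (hq : 1 ≤ q) (φ : EuclideanSpace ℝ (Fin N) → ℝ)
    (hφ : ContDiff ℝ 1 φ) (h : EuclideanSpace ℝ (Fin N)) :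
    ∫⁻ x, ‖φ (x + h) - φ x‖ₑ ^ q ≤ ‖h‖ₑ ^ q * ∫⁻ x, ‖fderiv ℝ φ x‖ₑ ^ q := by
  have hDc : Continuous (fderiv ℝ φ) := hφ.continuous_fderiv (by simp)
  have hq0 : 0 < q := by linarith
  have pt : ∀ x, ‖φ (x + h) - φ x‖ₑ ^ q ≤
      ∫⁻ t in Set.Ioc (0:ℝ) 1, (‖fderiv ℝ φ (x + t • h)‖ₑ * ‖h‖ₑ) ^ q := by
    intro x
    have hc : Continuous (fun t : ℝ => fderiv ℝ φ (x + t • h)) := hDc.comp (by fun_prop)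
    have e1 : φ (x + h) - φ x = ∫ t in (0:ℝ)..1, fderiv ℝ φ (x + t • h) h := by
      have := intervalIntegral.integral_eq_sub_of_hasDerivAt (a := 0) (b := 1)
        (f := fun t : ℝ => φ (x + t • h)) (f' := fun t => fderiv ℝ φ (x + t • h) h) ?_ ?_
      · rw [this]; simp
      · intro t _
        have h1 : HasFDerivAt φ (fderiv ℝ φ (x + t • h)) (x + t • h) :=
          (hφ.differentiable (by simp)).differentiableAt.hasFDerivAt
        have h2 : HasDerivAt (fun t : ℝ => x + t • h) h t := by
          simpa using ((hasDerivAt_id t).smul_const h).const_add x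
        exact h1.comp_hasDerivAt t h2
      · exact (hc.clm_apply continuous_const).intervalIntegrable _ _
    rw [intervalIntegral.integral_of_le zero_le_one] at e1
    have e2 : ‖φ (x + h) - φ x‖ₑ ≤
        ∫⁻ t in Set.Ioc (0:ℝ) 1, ‖fderiv ℝ φ (x + t • h)‖ₑ * ‖h‖ₑ := by
      rw [e1]
      refine (enorm_integral_le_lintegral_enorm _).trans ?_
      apply lintegral_mono
      intro t
      exact ContinuousLinearMap.le_opENorm _ _
    have e3 := ENNReal.lintegral_mul_norm_pow_le (μ := volume.restrict (Set.Ioc (0:ℝ) 1))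
      (f := fun t => (‖fderiv ℝ φ (x + t • h)‖ₑ * ‖h‖ₑ) ^ q) (g := fun _ => 1)
      (p := 1 / q) (q := 1 - 1 / q)
      (((hc.enorm.measurable.mul_const _).pow_const _).aemeasurable) aemeasurable_const
      (by positivity) (by rw [sub_nonneg, div_le_one hq0]; exact hq) (by ring)
    have e4 : ∀ y : ENNReal, (y ^ q) ^ (1 / q) = y := by
      intro y
      rw [← ENNReal.rpow_mul, mul_one_div_cancel hq0.ne', ENNReal.rpow_one]
    simp only [ENNReal.one_rpow, mul_one, e4, lintegral_one, Measure.restrict_apply_univ,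
      Real.volume_Ioc, sub_zero, ENNReal.ofReal_one] at e3
    rw [← ENNReal.le_rpow_inv_iff hq0, ← one_div]
    exact e2.trans e3
  calc ∫⁻ x, ‖φ (x + h) - φ x‖ₑ ^ q
      ≤ ∫⁻ x, ∫⁻ t in Set.Ioc (0:ℝ) 1, (‖fderiv ℝ φ (x + t • h)‖ₑ * ‖h‖ₑ) ^ q :=
        lintegral_mono pt
    _ = ∫⁻ t in Set.Ioc (0:ℝ) 1, ∫⁻ x, (‖fderiv ℝ φ (x + t • h)‖ₑ * ‖h‖ₑ) ^ q := by
        apply lintegral_lintegral_swap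
        apply Measurable.aemeasurable
        have : Continuous (fun p : EuclideanSpace ℝ (Fin N) × ℝ => fderiv ℝ φ (p.1 + p.2 • h)) :=
          hDc.comp (by fun_prop)
        exact (this.enorm.measurable.mul_const _).pow_const _
    _ = ∫⁻ t in Set.Ioc (0:ℝ) 1, ∫⁻ x, (‖fderiv ℝ φ x‖ₑ * ‖h‖ₑ) ^ q := by
        congr 1
        ext t
        exact lintegral_add_right_eq_self (fun x => (‖fderiv ℝ φ x‖ₑ * ‖h‖ₑ) ^ q) (t • h)
    _ = _ := by
        simp only [lintegral_const, Measure.restrict_apply_univ,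
          Real.volume_Ioc, sub_zero, ENNReal.ofReal_one, mul_one]
        simp_rw [ENNReal.mul_rpow_of_nonneg _ _ hq0.le]
        rw [lintegral_mul_const, mul_comm]
        exact hDc.enorm.measurable.pow_const _

lemma aux_C {N : ℕ} (hN : 3 ≤ N) (q p : ℝ) (hq : 1 ≤ q) (hp : 1 ≤ p)
    (hpq : p⁻¹ = q⁻¹ - (N : ℝ)⁻¹) :
    ∃ K : ENNReal, K ≠ ⊤ ∧ ∀ φ : EuclideanSpace ℝ (Fin N) → ℝ, ContDiff ℝ 1 φ →
      HasCompactSupport φ → ∀ h, ∫⁻ x, ‖φ (x + h) - φ x‖ₑ ^ p ≤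
        K * (∫⁻ x, ‖fderiv ℝ φ x‖ₑ ^ q) ^ (p / q) := by
  have hq0 : 0 < q := by linarith
  have hp0 : 0 < p := by linarith
  lift q to NNReal using hq0.le
  lift p to NNReal using hp0.le
  set S : ENNReal := ((SNormLESNormFDerivOfEqConst ℝ
    (volume : Measure (EuclideanSpace ℝ (Fin N))) q : NNReal) : ENNReal) with hS
  refine ⟨2 ^ ((p : ℝ) - 1) * 2 * S ^ (p : ℝ), ?_, ?_⟩
  · apply ENNReal.mul_ne_top
    · apply ENNReal.mul_ne_top _ (by simp)
      exact ENNReal.rpow_ne_top_of_nonneg (by linarith) (by simp)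
    · exact ENNReal.rpow_ne_top_of_nonneg hp0.le ENNReal.coe_ne_top
  intro φ hφ hφc h
  have g1 := eLpNorm_le_eLpNorm_fderiv_of_eq (F := ℝ)
    (volume : Measure (EuclideanSpace ℝ (Fin N))) hφ hφc (p := q) (p' := p)
    (by exact_mod_cast hq) (by rw [finrank_euclideanSpace_fin]; omega)
    (by rw [finrank_euclideanSpace_fin]; exact_mod_cast hpq)
  have g2 : ∫⁻ x, ‖φ x‖ₑ ^ (p:ℝ) ≤ S ^ (p:ℝ) * (∫⁻ x, ‖fderiv ℝ φ x‖ₑ ^ (q:ℝ)) ^ ((p:ℝ) / q) := by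
    have hp' : p ≠ 0 := by exact_mod_cast hp0.ne'
    have hq' : q ≠ 0 := by exact_mod_cast hq0.ne'
    rw [← eLpNorm_nnreal_pow_eq_lintegral hp', ← eLpNorm_nnreal_pow_eq_lintegral hq',
      ← ENNReal.rpow_mul, mul_div_cancel₀ _ hq0.ne', ← ENNReal.mul_rpow_of_nonneg _ _ hp0.le]
    gcongr
  calc ∫⁻ x, ‖φ (x + h) - φ x‖ₑ ^ (p:ℝ)
      ≤ ∫⁻ x, 2 ^ ((p:ℝ) - 1) * (‖φ (x + h)‖ₑ ^ (p:ℝ) + ‖φ x‖ₑ ^ (p:ℝ)) := by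
        apply lintegral_mono
        intro x
        refine le_trans ?_ (ENNReal.rpow_add_le_mul_rpow_add_rpow _ _ hp)
        exact ENNReal.rpow_le_rpow enorm_sub_le hp0.le
    _ = 2 ^ ((p:ℝ) - 1) * ((∫⁻ x, ‖φ x‖ₑ ^ (p:ℝ)) + ∫⁻ x, ‖φ x‖ₑ ^ (p:ℝ)) := by
        have m : Measurable (fun x => ‖φ x‖ₑ ^ (p:ℝ)) :=
          hφ.continuous.enorm.measurable.pow_const _
        have m2 : Measurable (fun x => ‖φ (x + h)‖ₑ ^ (p:ℝ)) :=
          m.comp (measurable_add_const h)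
        have m3 : Measurable (fun x => ‖φ (x + h)‖ₑ ^ (p:ℝ) + ‖φ x‖ₑ ^ (p:ℝ)) := m2.add m
        rw [lintegral_const_mul _ m3, lintegral_add_left m2,
          lintegral_add_right_eq_self (fun x => ‖φ x‖ₑ ^ (p:ℝ)) h]
    _ ≤ 2 ^ ((p:ℝ) - 1) * (S ^ (p:ℝ) * (∫⁻ x, ‖fderiv ℝ φ x‖ₑ ^ (q:ℝ)) ^ ((p:ℝ) / q) +
          S ^ (p:ℝ) * (∫⁻ x, ‖fderiv ℝ φ x‖ₑ ^ (q:ℝ)) ^ ((p:ℝ) / q)) := by gcongr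
    _ = _ := by ring

lemma aux_D {N : ℕ} (hN : 3 ≤ N) (q p r α : ℝ) (hq : 1 ≤ q) (hp : 1 ≤ p)
    (hpq : p⁻¹ = q⁻¹ - (N : ℝ)⁻¹) (hα0 : 0 ≤ α) (hα1 : α ≤ 1) (hr : α * q + (1 - α) * p = r) :
    ∃ K : ENNReal, K ≠ ⊤ ∧ ∀ φ : EuclideanSpace ℝ (Fin N) → ℝ, ContDiff ℝ 1 φ →
      HasCompactSupport φ → ∀ h, ∫⁻ x, ‖φ (x + h) - φ x‖ₑ ^ r ≤
        K * ‖h‖ₑ ^ (q * α) * (∫⁻ x, ‖fderiv ℝ φ x‖ₑ ^ q) ^ (r / q) := by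
  obtain ⟨K, hK, H⟩ := aux_C hN q p hq hp hpq
  refine ⟨K ^ (1 - α), ENNReal.rpow_ne_top_of_nonneg (by linarith) hK, ?_⟩
  intro φ hφ hφc h
  have m : Measurable (fun x => ‖φ (x + h) - φ x‖ₑ) := by
    apply Continuous.measurable
    apply Continuous.enorm
    exact (hφ.continuous.comp (continuous_add_const h)).sub hφ.continuous
  have s := ENNReal.lintegral_mul_norm_pow_le (μ := volume)
    (f := fun x => ‖φ (x + h) - φ x‖ₑ ^ q) (g := fun x => ‖φ (x + h) - φ x‖ₑ ^ p)
    (m.pow_const _).aemeasurable (m.pow_const _).aemeasurable hα0 (sub_nonneg.2 hα1) (by ring)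
  have hq0 : 0 < q := by linarith
  have hp0 : 0 < p := by linarith
  have hα1' : 0 ≤ 1 - α := by linarith
  have e : ∀ y : ENNReal, (y ^ q) ^ α * (y ^ p) ^ (1 - α) = y ^ r := by
    intro y
    rw [← ENNReal.rpow_mul, ← ENNReal.rpow_mul,
      ← ENNReal.rpow_add_of_nonneg _ _ (by positivity) (by positivity), ← hr]
    congr 1; ring
  simp only [e] at s
  refine s.trans ?_
  set I := ∫⁻ x, ‖fderiv ℝ φ x‖ₑ ^ q with hI
  calc _ ≤ (‖h‖ₑ ^ q * I) ^ α * (K * I ^ (p / q)) ^ (1 - α) := by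
        gcongr
        · exact aux_B q hq φ hφ h
        · exact H φ hφ hφc h
    _ = K ^ (1 - α) * ‖h‖ₑ ^ (q * α) * (I ^ α * I ^ (p / q * (1 - α))) := by
        rw [ENNReal.mul_rpow_of_nonneg _ _ hα0, ENNReal.mul_rpow_of_nonneg _ _ hα1',
          ← ENNReal.rpow_mul, ← ENNReal.rpow_mul]
        ring
    _ = _ := by
        rw [← ENNReal.rpow_add_of_nonneg _ _ hα0 (by positivity)]
        congr 2
        rw [← hr]; field_simp

lemma aux_E {N : ℕ} (hN : 3 ≤ N) (Ω : Set (EuclideanSpace ℝ (Fin N))) (hΩ : IsOpen Ω)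
    (R s q p r α : ℝ) (hR : ∀ x ∈ Ω, ‖x‖ ≤ R) (hs : 0 < s) (hr1 : 1 ≤ r)
    (hq : 1 ≤ q) (hp : 1 ≤ p)
    (hpq : p⁻¹ = q⁻¹ - (N : ℝ)⁻¹) (hα0 : 0 ≤ α) (hα1 : α ≤ 1) (hr : α * q + (1 - α) * p = r)
    (hsr : s * r < q * α) :
    ∃ K : ENNReal, K ≠ ⊤ ∧ ∀ φ : EuclideanSpace ℝ (Fin N) → ℝ, ContDiff ℝ 1 φ →
      HasCompactSupport φ →
      ∫⁻ x in Ω, ∫⁻ y in Ω, ‖|φ x - φ y| ^ r / ‖x - y‖ ^ ((N : ℝ) + s * r)‖ₑ ≤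
        K * (∫⁻ x, ‖fderiv ℝ φ x‖ₑ ^ q) ^ (r / q) := by
  obtain ⟨K, hK, H⟩ := aux_D hN q p r α hq hp hpq hα0 hα1 hr
  set e : ℝ := (N : ℝ) + s * r with he
  have he0 : 0 < e := by positivity
  set B := Metric.closedBall (0 : EuclideanSpace ℝ (Fin N)) (2 * R) with hB
  set K0 := ∫⁻ x in B, ENNReal.ofReal (‖x‖ ^ (-(e - q * α))) with hK0
  have hK0t : K0 < ⊤ := aux_ball_fin hN _ (by rw [he]; linarith) _
  refine ⟨K * K0, ENNReal.mul_ne_top hK hK0t.ne, ?_⟩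
  intro φ hφ hφc
  set I := ∫⁻ x, ‖fderiv ℝ φ x‖ₑ ^ q with hI
  have hr0 : 0 ≤ r := by linarith
  have pt : ∀ x y : EuclideanSpace ℝ (Fin N), ‖|φ x - φ y| ^ r / ‖x - y‖ ^ e‖ₑ =
      ‖φ y - φ x‖ₑ ^ r * ENNReal.ofReal (‖y - x‖ ^ (-e)) := by
    intro x y
    rw [← ofReal_norm, Real.norm_of_nonneg (by positivity), div_eq_mul_inv,
      ← Real.rpow_neg (norm_nonneg _), ENNReal.ofReal_mul (by positivity), norm_sub_rev x y,
      ← ENNReal.ofReal_rpow_of_nonneg (abs_nonneg _) hr0, abs_sub_comm, ← Real.norm_eq_abs,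
      ofReal_norm]
  have mδ : Measurable (fun z : EuclideanSpace ℝ (Fin N) × EuclideanSpace ℝ (Fin N) =>
      ‖φ (z.1 + z.2) - φ z.1‖ₑ ^ r * ENNReal.ofReal (‖z.2‖ ^ (-e))) := by
    apply Measurable.mul
    · apply Measurable.pow_const
      apply Continuous.measurable
      apply Continuous.enorm
      exact (hφ.continuous.comp (continuous_fst.add continuous_snd)).sub
        (hφ.continuous.comp continuous_fst)
    · exact (measurable_snd.norm.pow_const _).ennreal_ofReal
  calc ∫⁻ x in Ω, ∫⁻ y in Ω, ‖|φ x - φ y| ^ r / ‖x - y‖ ^ e‖ₑ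
      ≤ ∫⁻ x in Ω, ∫⁻ h in B, ‖φ (x + h) - φ x‖ₑ ^ r * ENNReal.ofReal (‖h‖ ^ (-e)) := by
        apply setLIntegral_mono' hΩ.measurableSet
        intro x hx
        simp_rw [pt]
        rw [← lintegral_indicator hΩ.measurableSet,
          ← lintegral_indicator Metric.isClosed_closedBall.measurableSet,
          ← lintegral_add_left_eq_self _ x]
        apply lintegral_mono
        intro h
        by_cases hh : x + h ∈ Ω
        · have hhB : h ∈ B := by
            rw [hB, mem_closedBall_zero_iff]
            have h1 := hR _ hh
            have h2 := hR _ hx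
            have h3 : ‖h‖ ≤ ‖x + h‖ + ‖x‖ := by
              have := norm_sub_le (x + h) x
              simpa using this
            linarith
          rw [hB] at hhB
          beta_reduce
          rw [Set.indicator_of_mem hh, Set.indicator_of_mem hhB]
          simp
        · simp [hh]
    _ ≤ ∫⁻ x, ∫⁻ h in B, ‖φ (x + h) - φ x‖ₑ ^ r * ENNReal.ofReal (‖h‖ ^ (-e)) :=
        setLIntegral_le_lintegral _ _
    _ = ∫⁻ h in B, ∫⁻ x, ‖φ (x + h) - φ x‖ₑ ^ r * ENNReal.ofReal (‖h‖ ^ (-e)) :=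
        lintegral_lintegral_swap mδ.aemeasurable
    _ ≤ ∫⁻ h in B, (K * I ^ (r / q)) * ENNReal.ofReal (‖h‖ ^ (-(e - q * α))) := by
        apply lintegral_mono
        intro h
        simp only
        have m : Measurable (fun x => ‖φ (x + h) - φ x‖ₑ ^ r) := by
          apply Measurable.pow_const
          apply Continuous.measurable
          apply Continuous.enorm
          exact (hφ.continuous.comp (continuous_add_const h)).sub hφ.continuous
        rw [lintegral_mul_const _ m]
        by_cases hh : h = 0
        · rw [hh, norm_zero, Real.zero_rpow (by linarith)]
          simp
        · have hh0 : 0 < ‖h‖ := norm_pos_iff.2 hh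
          have hqα : 0 ≤ q * α := by positivity
          calc _ ≤ K * ‖h‖ₑ ^ (q * α) * I ^ (r / q) * ENNReal.ofReal (‖h‖ ^ (-e)) := by
                gcongr
                exact H φ hφ hφc h
            _ = K * I ^ (r / q) * (‖h‖ₑ ^ (q * α) * ENNReal.ofReal (‖h‖ ^ (-e))) := by ring
            _ = _ := by
                rw [← ofReal_norm, ENNReal.ofReal_rpow_of_nonneg hh0.le hqα,
                  ← ENNReal.ofReal_mul (by positivity), ← Real.rpow_add hh0]
                congr 3
                ring
    _ = K * K0 * I ^ (r / q) := by
        rw [lintegral_const_mul _ (measurable_norm.pow_const _).ennreal_ofReal]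
        ring

lemma aux_F {N : ℕ} (hN : 3 ≤ N) (Ω : Set (EuclideanSpace ℝ (Fin N)))
    (R q p r α : ℝ) (hR0 : 0 < R) (hR : ∀ x ∈ Ω, ‖x‖ ≤ R) (hr1 : 1 ≤ r)
    (hq : 1 ≤ q) (hp : 1 ≤ p)
    (hpq : p⁻¹ = q⁻¹ - (N : ℝ)⁻¹) (hα0 : 0 ≤ α) (hα1 : α ≤ 1) (hr : α * q + (1 - α) * p = r) :
    ∃ K : ENNReal, K ≠ ⊤ ∧ ∀ φ : EuclideanSpace ℝ (Fin N) → ℝ, ContDiff ℝ 1 φ →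
      HasCompactSupport φ → tsupport φ ⊆ Ω →
      ∫⁻ x in Ω, ‖|φ x| ^ r‖ₑ ≤ K * (∫⁻ x, ‖fderiv ℝ φ x‖ₑ ^ q) ^ (r / q) := by
  obtain ⟨K, hK, H⟩ := aux_D hN q p r α hq hp hpq hα0 hα1 hr
  have hnt : Nontrivial (EuclideanSpace ℝ (Fin N)) := by
    apply Module.nontrivial_of_finrank_pos (R := ℝ)
    rw [finrank_euclideanSpace_fin]
    omega
  obtain ⟨h, hh⟩ := exists_norm_eq (EuclideanSpace ℝ (Fin N)) (c := 2 * R + 1) (by positivity)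
  have hqα : 0 ≤ q * α := by
    have : 0 < q := by linarith
    positivity
  refine ⟨K * ‖h‖ₑ ^ (q * α), ENNReal.mul_ne_top hK
    (ENNReal.rpow_ne_top_of_nonneg hqα enorm_ne_top), ?_⟩
  intro φ hφ hφc hφΩ
  refine le_trans ?_ (H φ hφ hφc h)
  refine (setLIntegral_le_lintegral _ _).trans ?_
  apply lintegral_mono
  intro x
  have hr0 : 0 < r := by linarith
  have e1 : ‖|φ x| ^ r‖ₑ = ‖φ x‖ₑ ^ r := by
    rw [← ofReal_norm, Real.norm_of_nonneg (by positivity),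
      ← ENNReal.ofReal_rpow_of_nonneg (abs_nonneg _) hr0.le, ← Real.norm_eq_abs, ofReal_norm]
  simp only [e1]
  by_cases hx : x ∈ tsupport φ
  · have : φ (x + h) = 0 := by
      apply image_eq_zero_of_notMem_tsupport
      intro h1
      have h2 := hR _ (hφΩ h1)
      have h3 := hR _ (hφΩ hx)
      have h4 : ‖h‖ ≤ ‖x + h‖ + ‖x‖ := by
        have := norm_sub_le (x + h) x
        simpa using this
      linarith
    rw [this, zero_sub, enorm_neg]
  · rw [image_eq_zero_of_notMem_tsupport hx, enorm_zero, ENNReal.zero_rpow_of_pos hr0]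
    exact zero_le

lemma aux_param (N : ℕ) (hN : 3 ≤ N) (s r : ℝ) (hs0 : 0 < s) (hs1 : s < 1) (hr1 : 1 ≤ r)
    (hr2 : r < 2 * N / ((N : ℝ) - 2 * (1 - s))) :
    ∃ q p α : ℝ, 1 ≤ q ∧ q < 2 ∧ 1 ≤ p ∧ p⁻¹ = q⁻¹ - (N : ℝ)⁻¹ ∧ 0 ≤ α ∧ α ≤ 1 ∧
      α * q + (1 - α) * p = r ∧ s * r < q * α := by
  have hN' : (3 : ℝ) ≤ N := by exact_mod_cast hN
  have hr0 : 0 < r := by linarith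
  have hq : ∃ q : ℝ, 1 ≤ q ∧ q < 2 ∧ q ≤ r ∧ r * N < (N + r * (1 - s)) * q := by
    by_cases h : r < 2
    · refine ⟨r, hr1, h, le_rfl, ?_⟩
      have : 0 < r * (1 - s) * r := by
        have : 0 < 1 - s := by linarith
        positivity
      linarith
    · push Not at h
      rw [lt_div_iff₀ (by linarith)] at hr2
      have hD : 0 < N + r * (1 - s) := by
        have : 0 < 1 - s := by linarith
        positivity
      have h1 : r * N / (N + r * (1 - s)) < 2 := by
        rw [div_lt_iff₀ hD]; linarith
      obtain ⟨q, hq1, hq2⟩ := exists_between (max_lt h1 (by norm_num : (1:ℝ) < 2))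
      rw [max_lt_iff] at hq1
      refine ⟨q, hq1.2.le, hq2, by linarith, ?_⟩
      rw [div_lt_iff₀ hD] at hq1
      linarith [hq1.1]
  obtain ⟨q, hq1, hq2, hqr, hq3⟩ := hq
  have hq0 : 0 < q := by linarith
  have hNq : 0 < N - q := by linarith
  set p := N * q / (N - q) with hp
  have hpq : p - q = q ^ 2 / (N - q) := by rw [hp]; field_simp; ring
  have hpq0 : 0 < p - q := by rw [hpq]; positivity
  set α := (p - r) / (p - q) with hα
  have hqα : q * α = (N * q - r * N + r * q) / q := by
    rw [hα, hpq, hp]; field_simp; ring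
  have hsr : s * r < q * α := by
    rw [hqα, lt_div_iff₀ hq0]; linarith
  have hα0 : 0 < α := by
    have : 0 < q * α := lt_trans (by positivity) hsr
    exact pos_of_mul_pos_right this hq0.le
  refine ⟨q, p, α, hq1, hq2, by linarith, ?_, hα0.le, ?_, ?_, hsr⟩
  · rw [hp]; field_simp
  · rw [hα, div_le_one hpq0]; linarith
  · rw [hα]; field_simp; ring

/-- **Improved Hardy–Poincaré inequality with fractional Sobolev `W^{s,r}`-norm.**
For `N ≥ 3`, a bounded open `Ω ⊆ ℝ^N`, `0 < s < 1` and `1 ≤ r < 2N/(N − 2(1−s))`,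
there is `C = C(s, r, Ω) > 0` such that for every test function `φ` on `Ω`,
`∫_Ω ‖∇φ‖² − μ* ∫_Ω φ²/‖x‖² ≥ C (∫_Ω |φ|^r + ∫_Ω∫_Ω |φ(x)−φ(y)|^r/‖x−y‖^{N+sr})^{2/r}`. -/
theorem improved_hardy_Wsr (N : ℕ) (hN : 3 ≤ N)
    (Ω : Set (EuclideanSpace ℝ (Fin N))) (hΩo : IsOpen Ω) (hΩb : Bornology.IsBounded Ω)
    (s r : ℝ) (hs0 : 0 < s) (hs1 : s < 1) (hr1 : 1 ≤ r)
    (hr2 : r < 2 * N / ((N : ℝ) - 2 * (1 - s))) :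
    ∃ C : ℝ, 0 < C ∧
      ∀ φ : EuclideanSpace ℝ (Fin N) → ℝ,
        ContDiff ℝ (⊤ : ℕ∞) φ → HasCompactSupport φ → tsupport φ ⊆ Ω →
        C * ((∫ x in Ω, |φ x| ^ r) +
              ∫ x in Ω, ∫ y in Ω, |φ x - φ y| ^ r / ‖x - y‖ ^ ((N : ℝ) + s * r)) ^ (2 / r) ≤
          (∫ x in Ω, ‖gradient φ x‖ ^ 2) -
            (((N : ℝ) - 2) / 2) ^ 2 * ∫ x in Ω, (φ x) ^ 2 / ‖x‖ ^ 2 := by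
  obtain ⟨q, p, α, hq, hq2, hp, hpq, hα0, hα1, hr, hsr⟩ := aux_param N hN s r hs0 hs1 hr1 hr2
  obtain ⟨R, hR0, hR⟩ := hΩb.exists_pos_norm_le
  obtain ⟨K1, hK1, H1⟩ := aux_F hN Ω R q p r α hR0 hR hr1 hq hp hpq hα0 hα1 hr
  obtain ⟨K2, hK2, H2⟩ := aux_E hN Ω hΩo R s q p r α hR hs0 hr1 hq hp hpq hα0 hα1 hr hsr
  obtain ⟨K3, hK3, H3⟩ := aux_A3 hN q R hq hq2
  have hq0 : 0 < q := by linarith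
  have hr0 : 0 < r := by linarith
  set M : ENNReal := (K1 + K2) ^ (2 / r) * K3 ^ (2 / q) with hM
  have hMt : M ≠ ⊤ := by
    apply ENNReal.mul_ne_top
    · exact ENNReal.rpow_ne_top_of_nonneg (by positivity) (ENNReal.add_ne_top.2 ⟨hK1, hK2⟩)
    · exact ENNReal.rpow_ne_top_of_nonneg (by positivity) hK3
  refine ⟨1 / (M.toReal + 1), by positivity, ?_⟩
  intro φ hφ' hφc hφΩ
  have hφ : ContDiff ℝ 1 φ := hφ'.of_le (by exact_mod_cast le_top)
  obtain ⟨hH0, hH⟩ := H3 φ hφ hφc (fun x hx => hR x (hφΩ hx))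
  have eg : ∀ x, ‖gradient φ x‖ = ‖fderiv ℝ φ x‖ := by
    intro x
    simp [gradient]
  have r1 : ∫ x in Ω, ‖gradient φ x‖ ^ 2 = ∫ x, ‖fderiv ℝ φ x‖ ^ 2 := by
    simp_rw [eg]
    apply setIntegral_eq_integral_of_forall_compl_eq_zero
    intro x hx
    have : fderiv ℝ φ x = 0 := by
      by_contra h
      exact hx (hφΩ (support_fderiv_subset ℝ h))
    simp [this]
  have r2 : ∫ x in Ω, φ x ^ 2 / ‖x‖ ^ 2 = ∫ x, φ x ^ 2 / ‖x‖ ^ 2 := by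
    apply setIntegral_eq_integral_of_forall_compl_eq_zero
    intro x hx
    have : φ x = 0 := image_eq_zero_of_notMem_tsupport fun h => hx (hφΩ h)
    simp [this]
  rw [r1, r2]
  set Hφ := (∫ x, ‖fderiv ℝ φ x‖ ^ 2) - (((N : ℝ) - 2) / 2) ^ 2 * ∫ x, φ x ^ 2 / ‖x‖ ^ 2 with hHφ
  set T := (∫ x in Ω, |φ x| ^ r) +
    ∫ x in Ω, ∫ y in Ω, |φ x - φ y| ^ r / ‖x - y‖ ^ ((N : ℝ) + s * r) with hT
  have hT0 : 0 ≤ T := by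
    apply add_nonneg
    · apply integral_nonneg; intro x; positivity
    · apply integral_nonneg; intro x
      apply integral_nonneg; intro y; positivity
  set I := ∫⁻ x, ‖fderiv ℝ φ x‖ₑ ^ q with hI
  have t1 : ENNReal.ofReal T ≤ (K1 + K2) * I ^ (r / q) := by
    have : ENNReal.ofReal T = ‖T‖ₑ := by rw [← ofReal_norm, Real.norm_of_nonneg hT0]
    rw [this, hT, add_mul]
    refine (enorm_add_le _ _).trans (add_le_add ?_ ?_)
    · exact (enorm_integral_le_lintegral_enorm _).trans (H1 φ hφ hφc hφΩ)
    · refine le_trans ?_ (H2 φ hφ hφc)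
      refine (enorm_integral_le_lintegral_enorm _).trans ?_
      apply lintegral_mono
      intro x
      exact enorm_integral_le_lintegral_enorm _
  have t2 : ENNReal.ofReal (T ^ (2 / r)) ≤ ENNReal.ofReal (M.toReal * Hφ) := by
    rw [ENNReal.ofReal_mul (by positivity), ENNReal.ofReal_toReal hMt,
      ← ENNReal.ofReal_rpow_of_nonneg hT0 (by positivity)]
    calc ENNReal.ofReal T ^ (2 / r) ≤ ((K1 + K2) * I ^ (r / q)) ^ (2 / r) := by gcongr
      _ = (K1 + K2) ^ (2 / r) * I ^ (2 / q) := by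
        rw [ENNReal.mul_rpow_of_nonneg _ _ (by positivity), ← ENNReal.rpow_mul]
        congr 2
        field_simp
      _ ≤ (K1 + K2) ^ (2 / r) * (K3 * ENNReal.ofReal Hφ ^ (q / 2)) ^ (2 / q) := by gcongr
      _ = M * ENNReal.ofReal Hφ := by
        rw [ENNReal.mul_rpow_of_nonneg _ _ (by positivity), ← ENNReal.rpow_mul]
        have : q / 2 * (2 / q) = 1 := by field_simp
        rw [this, ENNReal.rpow_one, hM, mul_assoc]
  have t3 : T ^ (2 / r) ≤ M.toReal * Hφ :=
    (ENNReal.ofReal_le_ofReal_iff (by positivity)).1 t2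
  rw [one_div, inv_mul_le_iff₀ (by positivity)]
  linarith
end
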